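/- arXiv:math/0209340 — 9 statements merged into one kernel-verified Lean document; each statement's English description precedes it below -/
import Mathlib

section
/- Fix n ≥ 3. For m ≥ 1 let s_m denote the number of permutations of length m that avoid both 123 and 231 as consecutive patterns, and for 1 ≤ i ≤ m let s_m(i) denote the number of such permutations whose first letter is i. Then: (a) s_n(n) = s_{n-1}; (b) for every 1 ≤ i ≤ n-1, s_n(i) = ∑_{j=1}^{i-1} s_{n-1}(j) + ∑_{j=i}^{n-2} (n-1-j)·s_{n-2}(j); and (c) s_n = s_{n-1} + ∑_{i=1}^{n-1} s_n(i). -/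
/-- `π` avoids 123 as a consecutive pattern: no three adjacent letters are in
increasing order. -/
def Avoids123Cons {n : ℕ} (π : Equiv.Perm (Fin n)) : Prop :=
  ∀ i : ℕ, ∀ h : i + 2 < n,
    ¬ (π ⟨i, by omega⟩ < π ⟨i + 1, by omega⟩ ∧ π ⟨i + 1, by omega⟩ < π ⟨i + 2, h⟩)

/-- `π` avoids 231 as a consecutive pattern: no three adjacent letters are
order-isomorphic to 231. -/
def Avoids231Cons {n : ℕ} (π : Equiv.Perm (Fin n)) : Prop :=
  ∀ i : ℕ, ∀ h : i + 2 < n,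
    ¬ (π ⟨i + 2, h⟩ < π ⟨i, by omega⟩ ∧ π ⟨i, by omega⟩ < π ⟨i + 1, by omega⟩)

/-- `s m` is the number of permutations of length `m` avoiding both 123 and 231
as consecutive patterns. -/
noncomputable def s (m : ℕ) : ℕ :=
  Nat.card {π : Equiv.Perm (Fin m) // Avoids123Cons π ∧ Avoids231Cons π}

/-- `sF m i` is the number of permutations of length `m` avoiding both 123 and 231
as consecutive patterns whose first letter is `i` (letters being `1, …, m`). -/
noncomputable def sF (m i : ℕ) : ℕ :=
  Nat.card {π : Equiv.Perm (Fin m) //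
    (Avoids123Cons π ∧ Avoids231Cons π) ∧ ∃ h : 0 < m, ((π ⟨0, h⟩ : Fin m) : ℕ) + 1 = i}

open scoped Classical in
theorem sum_first (m : ℕ) (f : ℕ → ℕ) :
    ∑ π : Equiv.Perm (Fin (m+1)), (if Avoids123Cons π ∧ Avoids231Cons π then f ((π 0 : ℕ) + 1) else 0)
      = ∑ j ∈ Finset.Icc 1 (m+1), f j * sF (m+1) j := by
  have h : ∀ j, sF (m+1) j = ∑ π : Equiv.Perm (Fin (m+1)),
      if (Avoids123Cons π ∧ Avoids231Cons π) ∧ (π 0 : ℕ) + 1 = j then 1 else 0 := by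
    intro j
    rw [sF, Nat.card_eq_fintype_card, Fintype.card_subtype, Finset.card_filter]
    apply Finset.sum_congr rfl
    intro π _
    congr 1
    simp
  simp_rw [h, Finset.mul_sum]
  rw [Finset.sum_comm]
  apply Finset.sum_congr rfl
  intro π _
  by_cases hA : Avoids123Cons π ∧ Avoids231Cons π
  · have : (π 0 : ℕ) < m + 1 := (π 0).2
    simp [hA]
    omega
  · simp [hA]

noncomputable def insP {m : ℕ} (a : Fin (m+1)) (σ : Equiv.Perm (Fin m)) : Equiv.Perm (Fin (m+1)) :=
  Equiv.ofBijective (Fin.cons a (a.succAbove ∘ σ) : Fin (m+1) → Fin (m+1))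
    (Finite.injective_iff_bijective.1 (by
      rw [Fin.cons_injective_iff]
      refine ⟨?_, Fin.succAbove_right_injective.comp σ.injective⟩
      rintro ⟨x, hx⟩
      exact Fin.succAbove_ne _ _ hx))

theorem insP_zero {m : ℕ} (a : Fin (m+1)) (σ : Equiv.Perm (Fin m)) : insP a σ 0 = a := rfl

theorem insP_succ {m : ℕ} (a : Fin (m+1)) (σ : Equiv.Perm (Fin m)) (i : Fin m) :
    insP a σ i.succ = a.succAbove (σ i) := rfl

theorem insP_bij (m : ℕ) : Function.Bijective
    (fun p : Fin (m+1) × Equiv.Perm (Fin m) => insP p.1 p.2) := by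
  rw [Fintype.bijective_iff_injective_and_card]
  constructor
  · rintro ⟨a, σ⟩ ⟨b, τ⟩ h
    dsimp only at h
    have h0 : a = b := by
      have := congrArg (fun π => π 0) h
      simpa [insP_zero] using this
    subst h0
    have : σ = τ := by
      ext1 i
      have := congrArg (fun π => π i.succ) h
      simpa [insP_succ] using this
    rw [this]
  · simp [Fintype.card_perm, Nat.factorial_succ]

theorem sum_ins (m : ℕ) (f : Equiv.Perm (Fin (m+1)) → ℕ) :
    ∑ π, f π = ∑ a, ∑ σ, f (insP a σ) := by
  rw [← Fintype.sum_prod_type', ← (insP_bij m).sum_comp]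

theorem avoid_ins {m : ℕ} (a : Fin (m+3)) (σ : Equiv.Perm (Fin (m+2))) :
    (Avoids123Cons (insP a σ) ∧ Avoids231Cons (insP a σ)) ↔
    (Avoids123Cons σ ∧ Avoids231Cons σ) ∧
      ((σ 0 : ℕ) < a ∨ ((a : ℕ) ≤ σ 1 ∧ (σ 1 : ℕ) < σ 0)) := by
  have hs : ∀ i (h : i + 1 < m + 3), insP a σ ⟨i+1, h⟩ = a.succAbove (σ ⟨i, by omega⟩) :=
    fun i h => insP_succ a σ ⟨i, by omega⟩
  have h0 : ∀ h : 0 < m + 3, insP a σ ⟨0, h⟩ = a := fun h => rfl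
  have hne : (σ 0 : ℕ) ≠ σ 1 := by
    intro h
    have := σ.injective (Fin.ext h)
    simp at this
  have e0 : ∀ h, σ ⟨0, h⟩ = σ 0 := fun _ => rfl
  have e1 : ∀ h, σ ⟨1, h⟩ = σ 1 := fun _ => rfl
  have key : ∀ P Q : ℕ → Prop, (∀ i, P (i+1) ↔ Q i) → ((∀ i, P i) ↔ P 0 ∧ ∀ i, Q i) := by
    intro P Q h
    constructor
    · intro hp
      exact ⟨hp 0, fun i => (h i).1 (hp _)⟩
    · rintro ⟨h1, h2⟩ (_ | i)
      · exact h1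
      · exact (h i).2 (h2 i)
  unfold Avoids123Cons Avoids231Cons
  rw [key _ (fun i => ∀ h : i + 2 < m + 2, ¬ (σ ⟨i, by omega⟩ < σ ⟨i + 1, by omega⟩ ∧ σ ⟨i + 1, by omega⟩ < σ ⟨i + 2, h⟩)),
    key (fun i => ∀ h : i + 2 < m + 3,
    ¬ (insP a σ ⟨i + 2, h⟩ < insP a σ ⟨i, by omega⟩ ∧ insP a σ ⟨i, by omega⟩ < insP a σ ⟨i + 1, by omega⟩)) (fun i => ∀ h : i + 2 < m + 2, ¬ (σ ⟨i + 2, h⟩ < σ ⟨i, by omega⟩ ∧ σ ⟨i, by omega⟩ < σ ⟨i + 1, by omega⟩))]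
  · have w : ((∀ h : 0 + 2 < m + 3, ¬ (insP a σ ⟨0, by omega⟩ < insP a σ ⟨0 + 1, by omega⟩ ∧ insP a σ ⟨0 + 1, by omega⟩ < insP a σ ⟨0 + 2, h⟩)) ∧ (∀ h : 0 + 2 < m + 3,
      ¬ (insP a σ ⟨0 + 2, h⟩ < insP a σ ⟨0, by omega⟩ ∧ insP a σ ⟨0, by omega⟩ < insP a σ ⟨0 + 1, by omega⟩))) ↔
      ((σ 0 : ℕ) < a ∨ ((a : ℕ) ≤ σ 1 ∧ (σ 1 : ℕ) < σ 0)) := by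
      have h2 : 0 + 2 < m + 3 := by omega
      simp only [h2, forall_true_left, h0]
      rw [hs 0 (by omega), hs (0+1) (by omega), Fin.succAbove_lt_succAbove_iff,
        Fin.lt_succAbove_iff_le_castSucc, Fin.succAbove_lt_iff_castSucc_lt]
      simp only [zero_add, e0, e1, Fin.lt_def, Fin.le_def, Fin.val_castSucc]
      omega
    rw [← w]
    tauto
  · intro i
    simp only [hs, Fin.succAbove_lt_succAbove_iff, add_right_comm i 1 2, Nat.add_lt_add_iff_right]
  · intro i
    simp only [hs, Fin.succAbove_lt_succAbove_iff, add_right_comm i 1 2, Nat.add_lt_add_iff_right]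

/-- inserting a larger first letter is harmless -/
theorem avoid_ins_gt {m : ℕ} (b : Fin (m+2)) (τ : Equiv.Perm (Fin (m+1))) (h : (τ 0 : ℕ) < b) :
    (Avoids123Cons (insP b τ) ∧ Avoids231Cons (insP b τ)) ↔
    (Avoids123Cons τ ∧ Avoids231Cons τ) := by
  cases m with
  | zero =>
    constructor <;> intro _ <;> constructor <;> intro i hi <;> omega
  | succ m =>
    rw [avoid_ins]
    tauto

theorem s_eq_sum (m : ℕ) : s (m+1) = ∑ j ∈ Finset.Icc 1 (m+1), sF (m+1) j := by
  classical
  have := sum_first m (fun _ => 1)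
  simp only [one_mul] at this
  rw [← this, s, Nat.card_eq_fintype_card, Fintype.card_subtype, Finset.card_filter]

theorem sF_main (m a : ℕ) (ha : a < m + 3) :
    sF (m+3) (a+1) = (∑ j ∈ Finset.Icc 1 a, sF (m+2) j)
      + ∑ j ∈ Finset.Icc (a+1) (m+1), (m + 2 - j) * sF (m+1) j := by
  classical
  have h1 : sF (m+3) (a+1) = ∑ σ : Equiv.Perm (Fin (m+2)),
      if Avoids123Cons (insP ⟨a, ha⟩ σ) ∧ Avoids231Cons (insP ⟨a, ha⟩ σ) then 1 else 0 := by
    have := sum_first (m+2) (fun j => if j = a + 1 then 1 else 0)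
    have e : ∑ j ∈ Finset.Icc 1 (m+2+1), (if j = a + 1 then 1 else 0) * sF (m+2+1) j
        = sF (m+3) (a+1) := by
      simp
      omega
    rw [e] at this
    rw [← this, sum_ins, Finset.sum_eq_single ⟨a, ha⟩]
    · simp [insP_zero]
    · intro b _ hb
      have : (b : ℕ) ≠ a := fun h => hb (Fin.ext h)
      simp [insP_zero, this]
    · simp
  have h2 : ∀ σ : Equiv.Perm (Fin (m+2)),
      (if Avoids123Cons (insP ⟨a, ha⟩ σ) ∧ Avoids231Cons (insP ⟨a, ha⟩ σ) then 1 else 0)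
      = (if Avoids123Cons σ ∧ Avoids231Cons σ then (if (σ 0 : ℕ) + 1 ≤ a then 1 else 0) else 0)
      + (if (Avoids123Cons σ ∧ Avoids231Cons σ) ∧ (a : ℕ) ≤ σ 1 ∧ (σ 1 : ℕ) < σ 0 then 1 else 0) := by
    intro σ
    rw [if_congr (avoid_ins _ _) rfl rfl]
    by_cases hA : Avoids123Cons σ ∧ Avoids231Cons σ
    · simp only [hA, true_and, and_self, if_true]
      split_ifs <;> omega
    · simp only [hA, false_and, if_false]
  rw [h1, Finset.sum_congr rfl (fun σ _ => h2 σ), Finset.sum_add_distrib]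
  congr 1
  · rw [sum_first (m+1) (fun j => if j ≤ a then 1 else 0)]
    by_cases hh : a ≤ m + 2
    · simp only [ite_mul, one_mul, zero_mul]
      rw [← Finset.sum_filter]
      apply Finset.sum_congr _ (fun _ _ => rfl)
      ext j
      simp
      omega
    · omega
  · rw [sum_ins, Finset.sum_comm]
    have h3 : ∀ τ : Equiv.Perm (Fin (m+1)), (∑ b : Fin (m+1+1),
        if (Avoids123Cons (insP b τ) ∧ Avoids231Cons (insP b τ)) ∧ (a : ℕ) ≤ insP b τ 1 ∧ (insP b τ 1 : ℕ) < insP b τ 0 then 1 else 0)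
        = if Avoids123Cons τ ∧ Avoids231Cons τ then (if a + 1 ≤ (τ 0 : ℕ) + 1 then m + 2 - ((τ 0 : ℕ) + 1) else 0) else 0 := by
      intro τ
      have h4 : ∀ b : Fin (m+1+1), ((Avoids123Cons (insP b τ) ∧ Avoids231Cons (insP b τ)) ∧ (a : ℕ) ≤ insP b τ 1 ∧ (insP b τ 1 : ℕ) < insP b τ 0)
          ↔ ((Avoids123Cons τ ∧ Avoids231Cons τ) ∧ a + 1 ≤ (τ 0 : ℕ) + 1) ∧ (τ 0).castSucc < b := by
        intro b
        have e1 : insP b τ 1 = b.succAbove (τ 0) := insP_succ b τ 0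
        rw [insP_zero, e1, ← Fin.lt_def, Fin.succAbove_lt_iff_castSucc_lt]
        by_cases hb : (τ 0).castSucc < b
        · rw [avoid_ins_gt b τ hb, Fin.succAbove_of_castSucc_lt _ _ hb]
          simp [hb]
        · simp [hb]
      simp only [h4]
      by_cases hA : (Avoids123Cons τ ∧ Avoids231Cons τ) ∧ a + 1 ≤ (τ 0 : ℕ) + 1
      · rw [if_pos hA.1, if_pos hA.2]
        simp only [hA, true_and, and_self]
        rw [← Finset.card_filter, Finset.filter_lt_eq_Ioi, Fin.card_Ioi]
        simp
      · simp only [hA, false_and, if_false, Finset.sum_const_zero]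
        rw [← ite_and, if_neg hA]
    rw [Finset.sum_congr rfl (fun τ _ => h3 τ)]
    rw [sum_first m (fun j => if a + 1 ≤ j then m + 2 - j else 0)]
    simp only [ite_mul, zero_mul]
    rw [← Finset.sum_filter]
    apply Finset.sum_congr _ (fun _ _ => rfl)
    ext j
    simp
    omega

theorem avoid123_231_recurrence (n : ℕ) (hn : 3 ≤ n) :
    sF n n = s (n - 1) ∧
    (∀ i, 1 ≤ i → i ≤ n - 1 →
      sF n i = (∑ j ∈ Finset.Icc 1 (i - 1), sF (n - 1) j)
        + ∑ j ∈ Finset.Icc i (n - 2), (n - 1 - j) * sF (n - 2) j) ∧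
    s n = s (n - 1) + ∑ i ∈ Finset.Icc 1 (n - 1), sF n i := by
  obtain ⟨m, rfl⟩ : ∃ m, n = m + 3 := ⟨n - 3, by omega⟩
  have ha : sF (m+3) (m+3) = s (m+2) := by
    rw [sF_main m (m+2) (by omega), s_eq_sum]
    simp
  refine ⟨ha, ?_, ?_⟩
  · intro i h1 h2
    obtain ⟨a, rfl⟩ : ∃ a, i = a + 1 := ⟨i - 1, by omega⟩
    exact sF_main m a (by omega)
  · change s (m+3) = s (m+2) + ∑ i ∈ Finset.Icc 1 (m+2), sF (m+3) i
    rw [← ha, s_eq_sum, Finset.sum_Icc_succ_top (by omega), add_comm]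
end

section
/- For m ≥ 2 and 1 ≤ i,j ≤ m with i ≠ j, let b(m;i,j) denote the number of permutations of length m that avoid both 132 and 213 as consecutive patterns and satisfy π_1 = i and π_2 = j (and set b(m;i,i) = 0, which agrees with the count). Then for all n ≥ 3 and all 1 ≤ i,j ≤ n with i ≠ j: if i > j then b(n;i,j) = ∑_{k=1}^{i-1} b(n-1;j,k), and if i < j then b(n;i,j) = ∑_{k=1}^{i-1} b(n-1;j-1,k) + ∑_{k=j}^{n-1} b(n-1;j-1,k). Consequently the number of permutations of length n avoiding both 132 and 213 as consecutive patterns equals ∑_{1≤i,j≤n} b(n;i,j). -/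
/-- `π` avoids 132 as a consecutive pattern: no three adjacent letters are
order-isomorphic to 132. -/
def Avoids132Cons {n : ℕ} (π : Equiv.Perm (Fin n)) : Prop :=
  ∀ i : ℕ, ∀ h : i + 2 < n,
    ¬ (π ⟨i, by omega⟩ < π ⟨i + 2, h⟩ ∧ π ⟨i + 2, h⟩ < π ⟨i + 1, by omega⟩)

/-- `π` avoids 213 as a consecutive pattern: no three adjacent letters are
order-isomorphic to 213. -/
def Avoids213Cons {n : ℕ} (π : Equiv.Perm (Fin n)) : Prop :=
  ∀ i : ℕ, ∀ h : i + 2 < n,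
    ¬ (π ⟨i + 1, by omega⟩ < π ⟨i, by omega⟩ ∧ π ⟨i, by omega⟩ < π ⟨i + 2, h⟩)

/-- `b m i j` is the number of permutations of length `m` avoiding both 132 and 213
as consecutive patterns with first letter `i` and second letter `j`
(letters being `1, …, m`); note this is `0` when `i = j`. -/
noncomputable def b (m i j : ℕ) : ℕ :=
  Nat.card {π : Equiv.Perm (Fin m) //
    (Avoids132Cons π ∧ Avoids213Cons π) ∧
    ∃ h : 1 < m, ((π ⟨0, by omega⟩ : Fin m) : ℕ) + 1 = i ∧ ((π ⟨1, h⟩ : Fin m) : ℕ) + 1 = j}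

def AvB {n : ℕ} (π : Equiv.Perm (Fin n)) : Prop := Avoids132Cons π ∧ Avoids213Cons π

theorem sum_b (m i : ℕ) (T : Finset ℕ) :
    ∑ k ∈ T, b m i k = Nat.card {π : Equiv.Perm (Fin m) // AvB π ∧
      ∃ h : 1 < m, ((π ⟨0, by omega⟩ : Fin m) : ℕ) + 1 = i ∧ ((π ⟨1, h⟩ : Fin m) : ℕ) + 1 ∈ T} := by
  classical
  by_cases h : 1 < m
  · simp only [b, AvB, Nat.card_eq_fintype_card, Fintype.card_subtype, h, exists_true_left]
    rw [Finset.card_eq_sum_card_fiberwise (t := T)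
      (f := fun π : Equiv.Perm (Fin m) => ((π ⟨1, h⟩ : Fin m) : ℕ) + 1)]
    · apply Finset.sum_congr rfl
      intro k hk
      congr 1
      ext π
      simp only [Finset.mem_filter, Finset.mem_univ, true_and]
      constructor
      · rintro ⟨h1, h2, rfl⟩; exact ⟨⟨h1, h2, hk⟩, rfl⟩
      · rintro ⟨⟨h1, h2, _⟩, h3⟩; exact ⟨h1, h2, h3⟩
    · intro π hπ
      simp only [Finset.coe_filter, Finset.mem_univ, true_and, Set.mem_ofPred_eq] at hπ
      exact hπ.2.2
  · simp [b, h]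

theorem total (n : ℕ) (hn : 1 < n) :
    Nat.card {π : Equiv.Perm (Fin n) // Avoids132Cons π ∧ Avoids213Cons π}
      = ∑ i ∈ Finset.Icc 1 n, ∑ j ∈ Finset.Icc 1 n, b n i j := by
  classical
  simp only [sum_b]
  simp only [AvB, Nat.card_eq_fintype_card, Fintype.card_subtype, hn, exists_true_left]
  rw [Finset.card_eq_sum_card_fiberwise (t := Finset.Icc 1 n)
      (f := fun π : Equiv.Perm (Fin n) => ((π ⟨0, by omega⟩ : Fin n) : ℕ) + 1)]
  · apply Finset.sum_congr rfl
    intro k hk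
    congr 1
    ext π
    have := (π ⟨1, hn⟩).2
    simp only [Finset.mem_filter, Finset.mem_univ, true_and, Finset.mem_Icc]
    constructor
    · rintro ⟨h1, h2⟩; exact ⟨h1, h2, by omega, by omega⟩
    · rintro ⟨h1, h2, _⟩; exact ⟨h1, h2⟩
  · intro π hπ
    have := (π ⟨0, by omega⟩).2
    simp only [Finset.coe_Icc, Set.mem_Icc]
    omega

def extP {m : ℕ} (p : Fin (m+1)) (σ : Equiv.Perm (Fin m)) : Equiv.Perm (Fin (m+1)) :=
  ((finSuccEquiv' 0).trans σ.optionCongr).trans (finSuccEquiv' p).symm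

theorem extP_zero {m : ℕ} (p : Fin (m+1)) (σ : Equiv.Perm (Fin m)) (h : 0 < m + 1) :
    extP p σ ⟨0, h⟩ = p := by
  change extP p σ 0 = p
  simp [extP]

theorem extP_succ {m : ℕ} (p : Fin (m+1)) (σ : Equiv.Perm (Fin m)) (i : ℕ) (h : i + 1 < m + 1) :
    extP p σ ⟨i + 1, h⟩ = p.succAbove (σ ⟨i, by omega⟩) := by
  have : (⟨i + 1, h⟩ : Fin (m+1)) = Fin.succAbove 0 (⟨i, by omega⟩ : Fin m) := by
    simp
  rw [this]
  simp only [extP, Equiv.trans_apply, finSuccEquiv'_succAbove]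
  simp

theorem extP_inj {m : ℕ} (p : Fin (m+1)) : Function.Injective (extP p) := by
  intro σ τ h
  ext ⟨i, hi⟩
  have := congrArg (fun e => e ⟨i + 1, by omega⟩) h
  simp only [extP_succ] at this
  rw [Fin.succAbove_right_injective this]

theorem extP_surj {m : ℕ} (p : Fin (m+1)) (π : Equiv.Perm (Fin (m+1))) (h : π 0 = p) :
    ∃ σ, extP p σ = π := by
  have h1 : ∀ i : Fin m, ∃ j : Fin m, p.succAbove j = π i.succ := by
    intro i
    apply Fin.exists_succAbove_eq
    rw [← h]
    intro h2
    exact Fin.succ_ne_zero i (π.injective h2)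
  choose f hf using h1
  have finj : Function.Injective f := by
    intro a c hac
    have := hf a
    rw [hac, hf c] at this
    exact (Fin.succ_injective _ (π.injective this)).symm
  refine ⟨Equiv.ofBijective f (Finite.injective_iff_bijective.mp finj), ?_⟩
  ext ⟨i, hi⟩
  cases i with
  | zero => rw [extP_zero, ← h]; rfl
  | succ i => rw [extP_succ, Equiv.ofBijective_apply, hf]; rfl

theorem AvB_extP {m : ℕ} (hm : 2 ≤ m) (p : Fin (m+1)) (σ : Equiv.Perm (Fin m)) :
    AvB (extP p σ) ↔ AvB σ ∧
     ¬ (p < p.succAbove (σ ⟨1, by omega⟩) ∧ σ ⟨1, by omega⟩ < σ ⟨0, by omega⟩) ∧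
     ¬ (p.succAbove (σ ⟨0, by omega⟩) < p ∧ p < p.succAbove (σ ⟨1, by omega⟩)) := by
  constructor
  · rintro ⟨h1, h2⟩
    refine ⟨⟨fun i h => ?_, fun i h => ?_⟩, ?_, ?_⟩
    · have := h1 (i+1) (by omega)
      simpa only [show i + 1 + 2 = i + 2 + 1 from rfl, extP_succ, Fin.succAbove_lt_succAbove_iff] using this
    · have := h2 (i+1) (by omega)
      simpa only [show i + 1 + 2 = i + 2 + 1 from rfl, extP_succ, Fin.succAbove_lt_succAbove_iff] using this
    · have := h1 0 (by omega)
      simpa only [show 0 + 2 = 1 + 1 from rfl, extP_succ, extP_zero, Fin.succAbove_lt_succAbove_iff] using this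
    · have := h2 0 (by omega)
      simpa only [show 0 + 2 = 1 + 1 from rfl, extP_succ, extP_zero, Fin.succAbove_lt_succAbove_iff] using this
  · rintro ⟨⟨h1, h2⟩, h3, h4⟩
    constructor
    · rintro (_ | i) h
      · simpa only [show 0 + 2 = 1 + 1 from rfl, extP_succ, extP_zero, Fin.succAbove_lt_succAbove_iff] using h3
      · have := h1 i (by omega)
        simpa only [show i + 1 + 2 = i + 2 + 1 from rfl, extP_succ, Fin.succAbove_lt_succAbove_iff] using this
    · rintro (_ | i) h
      · simpa only [show 0 + 2 = 1 + 1 from rfl, extP_succ, extP_zero, Fin.succAbove_lt_succAbove_iff] using h4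
      · have := h2 i (by omega)
        simpa only [show i + 1 + 2 = i + 2 + 1 from rfl, extP_succ, Fin.succAbove_lt_succAbove_iff] using this

theorem succAbove_val {m : ℕ} (p : Fin (m+1)) (x : Fin m) :
    ((p.succAbove x : Fin (m+1)) : ℕ) = if (x : ℕ) < p then (x : ℕ) else x + 1 := by
  simp only [Fin.succAbove, Fin.lt_def, Fin.val_castSucc]
  split_ifs <;> simp

theorem b_step {m : ℕ} (hm : 2 ≤ m) (p : Fin (m+1)) (j j' : ℕ) (T : Finset ℕ)
    (H : ∀ x y : Fin m, x ≠ y →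
      ((¬ (p < p.succAbove y ∧ y < x) ∧ ¬ (p.succAbove x < p ∧ p < p.succAbove y)) ∧
        ((p.succAbove x : Fin (m+1)) : ℕ) + 1 = j ↔ (x : ℕ) + 1 = j' ∧ (y : ℕ) + 1 ∈ T)) :
    b (m+1) (p+1) j = ∑ k ∈ T, b m j' k := by
  rw [sum_b, b]
  symm
  have key : ∀ σ : Equiv.Perm (Fin m), 
      (AvB σ ∧ ∃ h : 1 < m, ((σ ⟨0, by omega⟩ : Fin m) : ℕ) + 1 = j' ∧ ((σ ⟨1, h⟩ : Fin m) : ℕ) + 1 ∈ T) ↔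
      ((Avoids132Cons (extP p σ) ∧ Avoids213Cons (extP p σ)) ∧ ∃ h : 1 < m + 1,
        ((extP p σ ⟨0, by omega⟩ : Fin (m+1)) : ℕ) + 1 = p + 1 ∧ ((extP p σ ⟨1, h⟩ : Fin (m+1)) : ℕ) + 1 = j) := by
    intro σ
    have h1 := AvB_extP hm p σ
    have h2 := H (σ ⟨0, by omega⟩) (σ ⟨1, by omega⟩) (by simp)
    have h3 := extP_succ p σ 0 (by omega)
    simp only [zero_add] at h3
    change _ ↔ (AvB _ ∧ _)
    simp only [extP_zero, h3, show 1 < m from hm, show 1 < m + 1 by omega, exists_true_left, true_and]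
    tauto
  refine Nat.card_eq_of_bijective (fun σ => ⟨extP p σ.1, (key σ.1).1 σ.2⟩) ⟨?_, ?_⟩
  · intro σ τ h
    exact Subtype.ext (extP_inj p (congrArg Subtype.val h))
  · rintro ⟨π, hπ⟩
    obtain ⟨σ, rfl⟩ := extP_surj p π (by
      obtain ⟨_, _, h, _⟩ := hπ
      exact Fin.ext (Nat.succ_injective h))
    exact ⟨⟨σ, (key σ).2 hπ⟩, rfl⟩

theorem avoid132_213_recurrence (n : ℕ) (hn : 3 ≤ n) :
    (∀ i j, 1 ≤ i → i ≤ n → 1 ≤ j → j ≤ n → i ≠ j →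
      (j < i → b n i j = ∑ k ∈ Finset.Icc 1 (i - 1), b (n - 1) j k) ∧
      (i < j → b n i j = (∑ k ∈ Finset.Icc 1 (i - 1), b (n - 1) (j - 1) k)
          + ∑ k ∈ Finset.Icc j (n - 1), b (n - 1) (j - 1) k)) ∧
    Nat.card {π : Equiv.Perm (Fin n) // Avoids132Cons π ∧ Avoids213Cons π}
      = ∑ i ∈ Finset.Icc 1 n, ∑ j ∈ Finset.Icc 1 n, b n i j := by
  refine ⟨?_, total n (by omega)⟩
  obtain ⟨m, rfl⟩ : ∃ m, n = m + 1 := ⟨n - 1, by omega⟩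
  intro i j hi hi' hj hj' hij
  obtain ⟨p, rfl⟩ : ∃ p, i = p + 1 := ⟨i - 1, by omega⟩
  simp only [Nat.add_sub_cancel]
  constructor
  · intro h
    refine b_step (by omega) (⟨p, by omega⟩ : Fin (m+1)) j j _ ?_
    intro x y hxy
    have hxy' : (x : ℕ) ≠ y := fun h => hxy (Fin.ext h)
    simp only [Fin.lt_def, succAbove_val, Finset.mem_Icc]
    split_ifs <;> omega
  · intro h
    rw [← Finset.sum_union]
    · refine b_step (by omega) (⟨p, by omega⟩ : Fin (m+1)) j (j-1) _ ?_
      intro x y hxy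
      have hxy' : (x : ℕ) ≠ y := fun h => hxy (Fin.ext h)
      have := y.2
      simp only [Fin.lt_def, succAbove_val, Finset.mem_Icc, Finset.mem_union]
      split_ifs <;> omega
    · rw [Finset.disjoint_left]
      intro a
      simp only [Finset.mem_Icc]
      omega
end

section
/- Fix k ≥ 1. For n ≥ 0 let a_n be the number of permutations of length n that avoid the classical pattern 1-3-2 and begin with the pattern k(k-1)⋯1 (so a_n = 0 for n < k). Then in the ring of formal power series with integer coefficients, ∑_{n≥0} a_n x^n = x^k · C(x)^{k+1}. -/
/-- `π` avoids the classical pattern 1-3-2: there are no indices `i < j < k`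
with `π i < π k < π j`. -/
def AvoidsC132 {n : ℕ} (π : Equiv.Perm (Fin n)) : Prop :=
  ¬ ∃ i j k : Fin n, i < j ∧ j < k ∧ π i < π k ∧ π k < π j

/-- `π` begins with the pattern `k(k-1)⋯1`: its first `k` letters are decreasing
(in particular the length is at least `k`). -/
def BeginsDec {n : ℕ} (π : Equiv.Perm (Fin n)) (k : ℕ) : Prop :=
  k ≤ n ∧ ∀ i j : Fin n, i < j → (j : ℕ) < k → π j < π i

/-- The number of permutations of length `n` avoiding the classical pattern 1-3-2
and beginning with the pattern `k(k-1)⋯1`. -/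
noncomputable def a (k n : ℕ) : ℕ :=
  Nat.card {π : Equiv.Perm (Fin n) // AvoidsC132 π ∧ BeginsDec π k}

def glueFun {i j n : ℕ} (h : i + j = n) (s : Equiv.Perm (Fin i)) (t : Equiv.Perm (Fin j))
    (p : Fin (n + 1)) : Fin (n + 1) :=
  if h1 : (p : ℕ) < i then ⟨(s ⟨p, h1⟩ : ℕ) + j, by have := (s ⟨p, h1⟩).2; omega⟩
  else if h2 : (p : ℕ) = i then ⟨n, by omega⟩
  else ⟨(t ⟨(p : ℕ) - i - 1, by have := p.2; omega⟩ : ℕ), by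
    have := (t ⟨(p : ℕ) - i - 1, by have := p.2; omega⟩).2; omega⟩

section
variable {i j n : ℕ} (h : i + j = n) (s : Equiv.Perm (Fin i)) (t : Equiv.Perm (Fin j))

theorem glueFun_lt (p : Fin (n + 1)) (h1 : (p : ℕ) < i) :
    (glueFun h s t p : ℕ) = s ⟨p, h1⟩ + j := by
  simp [glueFun, h1]

theorem glueFun_eq (p : Fin (n + 1)) (h1 : (p : ℕ) = i) :
    (glueFun h s t p : ℕ) = n := by
  simp [glueFun, h1]

theorem glueFun_gt (p : Fin (n + 1)) (q : Fin j) (h1 : (p : ℕ) = i + 1 + q) :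
    (glueFun h s t p : ℕ) = t q := by
  have h2 : ¬ (p : ℕ) < i := by omega
  have h3 : ¬ (p : ℕ) = i := by omega
  have h4 : (p : ℕ) - i - 1 = q := by omega
  simp [glueFun, h2, h3, h4]

theorem pos_cases (h : i + j = n) (p : Fin (n + 1)) :
    (∃ q : Fin i, (p : ℕ) = q) ∨ (p : ℕ) = i ∨ ∃ q : Fin j, (p : ℕ) = i + 1 + q := by
  rcases lt_trichotomy (p : ℕ) i with h1 | h1 | h1
  · exact Or.inl ⟨⟨p, h1⟩, rfl⟩
  · exact Or.inr (Or.inl h1)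
  · exact Or.inr (Or.inr ⟨⟨p - i - 1, by have := p.2; omega⟩, by simp only; omega⟩)

theorem glueFun_lt' (p : Fin (n + 1)) (q : Fin i) (h1 : (p : ℕ) = q) :
    (glueFun h s t p : ℕ) = s q + j := by
  rw [glueFun_lt h s t p (by omega)]
  simp [h1]

theorem glueFun_inj : Function.Injective (glueFun h s t) := by
  intro p q hpq
  have hv : (glueFun h s t p : ℕ) = glueFun h s t q := by rw [hpq]
  apply Fin.ext
  rcases pos_cases h p with ⟨p', hp⟩ | hp | ⟨p', hp⟩ <;>
  rcases pos_cases h q with ⟨q', hq⟩ | hq | ⟨q', hq⟩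
  · rw [glueFun_lt' h s t p p' hp, glueFun_lt' h s t q q' hq] at hv
    have : p' = q' := s.injective (Fin.ext (by omega))
    rw [hp, hq, this]
  · rw [glueFun_lt' h s t p p' hp, glueFun_eq h s t q hq] at hv
    have := (s p').2
    omega
  · rw [glueFun_lt' h s t p p' hp, glueFun_gt h s t q q' hq] at hv
    have := (t q').2
    omega
  · rw [glueFun_eq h s t p hp, glueFun_lt' h s t q q' hq] at hv
    have := (s q').2
    omega
  · omega
  · rw [glueFun_eq h s t p hp, glueFun_gt h s t q q' hq] at hv
    have := (t q').2
    omega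
  · rw [glueFun_gt h s t p p' hp, glueFun_lt' h s t q q' hq] at hv
    have := (t p').2
    omega
  · rw [glueFun_gt h s t p p' hp, glueFun_eq h s t q hq] at hv
    have := (t p').2
    omega
  · rw [glueFun_gt h s t p p' hp, glueFun_gt h s t q q' hq] at hv
    have : p' = q' := t.injective (Fin.ext (by omega))
    rw [hp, hq, this]

noncomputable def glue : Equiv.Perm (Fin (n + 1)) :=
  Equiv.ofBijective (glueFun h s t) (Finite.injective_iff_bijective.mp (glueFun_inj h s t))

theorem glue_lt (p : Fin (n + 1)) (q : Fin i) (h1 : (p : ℕ) = q) :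
    (glue h s t p : ℕ) = s q + j := glueFun_lt' h s t p q h1
theorem glue_eq (p : Fin (n + 1)) (h1 : (p : ℕ) = i) :
    (glue h s t p : ℕ) = n := glueFun_eq h s t p h1
theorem glue_gt (p : Fin (n + 1)) (q : Fin j) (h1 : (p : ℕ) = i + 1 + q) :
    (glue h s t p : ℕ) = t q := glueFun_gt h s t p q h1

theorem glue_av : AvoidsC132 (glue h s t) ↔ AvoidsC132 s ∧ AvoidsC132 t := by
  constructor
  · intro H
    constructor
    · rintro ⟨a, b, c, h1, h2, h3, h4⟩
      refine H ⟨⟨a, by omega⟩, ⟨b, by omega⟩, ⟨c, by omega⟩, h1, h2, ?_, ?_⟩ <;>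
      · rw [Fin.lt_def, glue_lt h s t _ _ rfl, glue_lt h s t _ _ rfl]
        omega
    · rintro ⟨a, b, c, h1, h2, h3, h4⟩
      refine H ⟨⟨i + 1 + a, by omega⟩, ⟨i + 1 + b, by omega⟩, ⟨i + 1 + c, by omega⟩,
        ?_, ?_, ?_, ?_⟩
      · rw [Fin.lt_def] at *; simp only; omega
      · rw [Fin.lt_def] at *; simp only; omega
      · rw [Fin.lt_def, glue_gt h s t _ _ rfl, glue_gt h s t _ _ rfl]
        omega
      · rw [Fin.lt_def, glue_gt h s t _ _ rfl, glue_gt h s t _ _ rfl]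
        omega
  · rintro ⟨Hs, Ht⟩ ⟨a, b, c, h1, h2, h3, h4⟩
    rw [Fin.lt_def] at h1 h2 h3 h4
    have hc := (glue h s t c).2
    have hb := (glue h s t b).2
    rcases pos_cases h c with ⟨c', hc'⟩ | hc' | ⟨c', hc'⟩
    · have ha' : (a : ℕ) < i := by omega
      have hb' : (b : ℕ) < i := by omega
      rw [glue_lt h s t c c' hc'] at h3 h4
      rw [glue_lt h s t a ⟨a, ha'⟩ rfl] at h3
      rw [glue_lt h s t b ⟨b, hb'⟩ rfl] at h4
      refine Hs ⟨⟨a, ha'⟩, ⟨b, hb'⟩, c', ?_, ?_, ?_, ?_⟩ <;> rw [Fin.lt_def] <;> (try simp only) <;> omega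
    · rw [glue_eq h s t c hc'] at h4
      omega
    · rw [glue_gt h s t c c' hc'] at h3 h4
      have := (t c').2
      rcases pos_cases h a with ⟨a', ha'⟩ | ha' | ⟨a', ha'⟩
      · rw [glue_lt h s t a a' ha'] at h3
        omega
      · rw [glue_eq h s t a ha'] at h3
        omega
      · rw [glue_gt h s t a a' ha'] at h3
        have hb' : (b : ℕ) = i + 1 + ((⟨b - i - 1, by have := b.2; omega⟩ : Fin j) : ℕ) := by
          simp only; omega
        rw [glue_gt h s t b _ hb'] at h4
        refine Ht ⟨a', _, c', ?_, ?_, h3, h4⟩ <;> rw [Fin.lt_def] <;> simp only <;> omega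

theorem glue_beg_zero : BeginsDec (glue h s t) 0 := ⟨by omega, by intros; omega⟩

theorem glue_beg_pos (hi : 0 < i) (k : ℕ) :
    BeginsDec (glue h s t) (k + 1) ↔ BeginsDec s (k + 1) := by
  constructor
  · rintro ⟨H1, H2⟩
    have hk : k + 1 ≤ i := by
      by_contra hk
      have := H2 ⟨0, by omega⟩ ⟨i, by omega⟩ (by rw [Fin.lt_def]; exact hi) (by simp only; omega)
      rw [Fin.lt_def, glue_eq h s t ⟨i, by omega⟩ rfl] at this
      have := (glue h s t ⟨0, by omega⟩).2
      omega
    refine ⟨hk, fun a b h1 h2 => ?_⟩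
    have := H2 ⟨a, by omega⟩ ⟨b, by omega⟩ h1 h2
    rw [Fin.lt_def, glue_lt h s t _ _ rfl, glue_lt h s t _ _ rfl] at this
    rw [Fin.lt_def]; omega
  · rintro ⟨H1, H2⟩
    refine ⟨by omega, fun a b h1 h2 => ?_⟩
    have h3 := H2 ⟨a, by omega⟩ ⟨b, by omega⟩ h1 h2
    rw [Fin.lt_def, glue_lt h s t a ⟨a, by omega⟩ rfl, glue_lt h s t b ⟨b, by omega⟩ rfl]
    rw [Fin.lt_def] at h3
    omega

theorem glue_beg_empty (hi : i = 0) (k : ℕ) :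
    BeginsDec (glue h s t) (k + 1) ↔ BeginsDec t k := by
  constructor
  · rintro ⟨H1, H2⟩
    refine ⟨by omega, fun a b h1 h2 => ?_⟩
    have := H2 ⟨i + 1 + a, by omega⟩ ⟨i + 1 + b, by omega⟩
      (by rw [Fin.lt_def] at *; simp only; omega) (by simp only; omega)
    rw [Fin.lt_def, glue_gt h s t _ _ rfl, glue_gt h s t _ _ rfl] at this
    exact this
  · rintro ⟨H1, H2⟩
    refine ⟨by omega, fun a b h1 h2 => ?_⟩
    rw [Fin.lt_def] at h1
    rcases pos_cases h b with ⟨b', hb'⟩ | hb' | ⟨b', hb'⟩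
    · omega
    · omega
    rw [Fin.lt_def, glue_gt h s t b b' hb']
    rcases pos_cases h a with ⟨a', ha'⟩ | ha' | ⟨a', ha'⟩
    · omega
    · rw [glue_eq h s t a ha']; omega
    · rw [glue_gt h s t a a' ha']
      exact H2 a' b' (by rw [Fin.lt_def]; omega) (by omega)

theorem glue_inj (s' : Equiv.Perm (Fin i)) (t' : Equiv.Perm (Fin j))
    (H : glue h s t = glue h s' t') : s = s' ∧ t = t' := by
  constructor
  · ext q
    have h1 := glue_lt h s t ⟨q, by omega⟩ q rfl
    rw [H, glue_lt h s' t' _ q rfl] at h1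
    omega
  · ext q
    have h1 := glue_gt h s t ⟨i + 1 + q, by omega⟩ q rfl
    rw [H, glue_gt h s' t' _ q rfl] at h1
    omega

theorem glue_surj (π : Equiv.Perm (Fin (n + 1))) (hav : AvoidsC132 π)
    (hm : (π ⟨i, by omega⟩ : ℕ) = n) : ∃ s t, glue h s t = π := by
  have key : ∀ p q : Fin (n + 1), (p : ℕ) < i → i < (q : ℕ) → π q < π p := by
    intro p q hp hq
    by_contra hc
    have hne : π p ≠ π q := fun e => by
      have := π.injective e
      subst this; omega
    have hlt : π p < π q := lt_of_le_of_ne (not_lt.mp hc) hne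
    refine hav ⟨p, ⟨i, by omega⟩, q, hp, hq, hlt, ?_⟩
    have hne : π q ≠ π ⟨i, by omega⟩ := fun e => by
      have := congrArg Fin.val (π.injective e)
      simp only at this; omega
    refine lt_of_le_of_ne ?_ hne
    rw [Fin.le_def, hm]
    have := (π q).2
    omega
  have hlow : ∀ p : Fin (n + 1), (p : ℕ) < i → j ≤ (π p : ℕ) := by
    intro p hp
    let f : Fin j → Fin (π p : ℕ) := fun q =>
      ⟨π ⟨i + 1 + q, by omega⟩, key p _ hp (by simp only; omega)⟩
    have hf : Function.Injective f := by
      intro q q' e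
      have e0 : (π ⟨i + 1 + q, by omega⟩ : ℕ) = π ⟨i + 1 + q', by omega⟩ :=
      (Fin.ext_iff.mp e :)
      have e1 : π ⟨i + 1 + q, by omega⟩ = π ⟨i + 1 + q', by omega⟩ := Fin.ext e0
      have := congrArg Fin.val (π.injective e1)
      simp only at this
      exact Fin.ext (by omega)
    simpa using Fintype.card_le_of_injective f hf
  have hnn : ∀ p : Fin (n + 1), (p : ℕ) ≠ i → (π p : ℕ) < n := by
    intro p hp
    have h1 : (π p : ℕ) ≠ n := fun e => by
      have := π.injective (Fin.ext (e.trans hm.symm))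
      subst this; simp at hp
    have := (π p).2
    omega
  have hhigh : ∀ q : Fin (n + 1), i < (q : ℕ) → (π q : ℕ) < j := by
    intro q hq
    let f : Fin i → Fin (n - 1 - (π q : ℕ)) := fun p =>
      ⟨n - 1 - π ⟨p, by omega⟩, by
        have h1 := key ⟨p, by omega⟩ q p.2 hq
        rw [Fin.lt_def] at h1
        have h2 := hnn ⟨p, by omega⟩ (by simp only; omega)
        omega⟩
    have hf : Function.Injective f := by
      intro p p' e
      have e0 : n - 1 - (π ⟨p, by omega⟩ : ℕ) = n - 1 - (π ⟨p', by omega⟩ : ℕ) :=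
        congrArg Fin.val e
      have h2 := hnn ⟨p, by omega⟩ (by simp only; omega)
      have h3 := hnn ⟨p', by omega⟩ (by simp only; omega)
      have e1 : π ⟨p, by omega⟩ = π ⟨p', by omega⟩ := Fin.ext (by omega)
      have := congrArg Fin.val (π.injective e1)
      exact Fin.ext this
    have h1 : i ≤ n - 1 - (π q : ℕ) := by simpa using Fintype.card_le_of_injective f hf
    have h2 := hnn q (by omega)
    have := q.2
    omega
  let sf : Fin i → Fin i := fun p => ⟨π ⟨p, by omega⟩ - j, by
    have h2 := hnn ⟨p, by omega⟩ (by simp only; omega)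
    have h3 := hlow ⟨p, by omega⟩ p.2
    omega⟩
  have hs : Function.Injective sf := by
    intro p p' e
    have e0 : (π ⟨p, by omega⟩ : ℕ) - j = (π ⟨p', by omega⟩ : ℕ) - j := congrArg Fin.val e
    have h2 := hlow ⟨p, by omega⟩ p.2
    have h3 := hlow ⟨p', by omega⟩ p'.2
    have e1 : π ⟨p, by omega⟩ = π ⟨p', by omega⟩ := Fin.ext (by omega)
    have := congrArg Fin.val (π.injective e1)
    exact Fin.ext this
  let tf : Fin j → Fin j := fun p => ⟨π ⟨i + 1 + p, by omega⟩, hhigh _ (by simp only; omega)⟩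
  have ht : Function.Injective tf := by
    intro q q' e
    have e0 : (π ⟨i + 1 + q, by omega⟩ : ℕ) = π ⟨i + 1 + q', by omega⟩ :=
      (Fin.ext_iff.mp e :)
    have e1 : π ⟨i + 1 + q, by omega⟩ = π ⟨i + 1 + q', by omega⟩ := Fin.ext e0
    have := congrArg Fin.val (π.injective e1)
    simp only at this
    exact Fin.ext (by omega)
  refine ⟨Equiv.ofBijective sf (Finite.injective_iff_bijective.mp hs),
    Equiv.ofBijective tf (Finite.injective_iff_bijective.mp ht), ?_⟩
  apply Equiv.ext
  intro p
  apply Fin.ext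
  rcases pos_cases h p with ⟨q, hq⟩ | hq | ⟨q, hq⟩
  · have e : (⟨q, by omega⟩ : Fin (n + 1)) = p := Fin.ext hq.symm
    rw [glue_lt h _ _ p q hq]
    simp only [Equiv.ofBijective_apply, sf, e]
    have := hlow p (by omega)
    omega
  · have e : (⟨i, by omega⟩ : Fin (n + 1)) = p := Fin.ext hq.symm
    rw [glue_eq h _ _ p hq, ← e, hm]
  · have e : (⟨i + 1 + q, by omega⟩ : Fin (n + 1)) = p := Fin.ext hq.symm
    rw [glue_gt h _ _ p q hq]
    simp only [Equiv.ofBijective_apply, tf, e]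

end

theorem card_fiber {i j n : ℕ} (h : i + j = n) (P : Equiv.Perm (Fin (n + 1)) → Prop)
    (Q : Equiv.Perm (Fin i) → Prop) (R : Equiv.Perm (Fin j) → Prop)
    (hP : ∀ s t, AvoidsC132 (glue h s t) ∧ P (glue h s t) ↔ Q s ∧ R t) :
    Nat.card {π : Equiv.Perm (Fin (n + 1)) //
      (AvoidsC132 π ∧ P π) ∧ (π.symm (Fin.last n) : ℕ) = i}
      = Nat.card {s // Q s} * Nat.card {t // R t} := by
  rw [← Nat.card_prod]
  symm
  have hl : ∀ s t, ((glue h s t).symm (Fin.last n) : ℕ) = i := by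
    intro s t
    have : (glue h s t).symm (Fin.last n) = ⟨i, by omega⟩ := by
      rw [Equiv.symm_apply_eq]
      apply Fin.ext
      rw [glue_eq h s t _ rfl]; rfl
    rw [this]
  refine Nat.card_eq_of_bijective
    (fun x : {s // Q s} × {t // R t} => ⟨glue h x.1.1 x.2.1,
      (hP _ _).mpr ⟨x.1.2, x.2.2⟩, hl _ _⟩) ⟨?_, ?_⟩
  · rintro ⟨⟨s, hs⟩, ⟨t, ht⟩⟩ ⟨⟨s', hs'⟩, ⟨t', ht'⟩⟩ e
    have := glue_inj h _ _ _ _ (congrArg Subtype.val e)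
    simp only at this
    obtain ⟨rfl, rfl⟩ := this
    rfl
  · rintro ⟨π, ⟨hav, hp⟩, hm⟩
    have hm' : (π ⟨i, by omega⟩ : ℕ) = n := by
      have : (⟨i, by omega⟩ : Fin (n + 1)) = π.symm (Fin.last n) := Fin.ext hm.symm
      rw [this]; simp
    obtain ⟨s, t, rfl⟩ := glue_surj h π hav hm'
    have := (hP s t).mp ⟨hav, hp⟩
    exact ⟨⟨⟨s, this.1⟩, ⟨t, this.2⟩⟩, rfl⟩

theorem a_sum (k n : ℕ) : a k (n + 1) = ∑ p ∈ Finset.HasAntidiagonal.antidiagonal n,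
    Nat.card {π : Equiv.Perm (Fin (n + 1)) //
      (AvoidsC132 π ∧ BeginsDec π k) ∧ (π.symm (Fin.last n) : ℕ) = p.1} := by
  classical
  rw [Finset.Nat.sum_antidiagonal_eq_sum_range_succ_mk]
  simp only [a, Nat.card_eq_fintype_card, Fintype.card_subtype]
  rw [Finset.card_eq_sum_card_fiberwise (t := Finset.range (n + 1))
    (f := fun π : Equiv.Perm (Fin (n + 1)) => (π.symm (Fin.last n) : ℕ))]
  · simp only [Finset.filter_filter]
  · intro π _
    have := (π.symm (Fin.last n)).2
    simpa using Nat.lt_succ_iff.mp this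

theorem a_zero_eq (n : ℕ) : a 0 n = Nat.card {π : Equiv.Perm (Fin n) // AvoidsC132 π} := by
  unfold a
  refine Nat.card_congr (Equiv.subtypeEquivRight fun π => ?_)
  exact ⟨fun h => h.1, fun h => ⟨h, by omega, by intros; omega⟩⟩

theorem a_zero_zero : a 0 0 = 1 := by
  rw [a_zero_eq, Nat.card_eq_one_iff_unique]
  refine ⟨⟨fun x y => Subtype.ext (Subsingleton.elim _ _)⟩, ⟨⟨1, ?_⟩⟩⟩
  rintro ⟨x, _⟩
  exact x.elim0

theorem a_succ_zero (k : ℕ) : a (k + 1) 0 = 0 := by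
  have : IsEmpty {π : Equiv.Perm (Fin 0) // AvoidsC132 π ∧ BeginsDec π (k + 1)} :=
    ⟨fun x => by have := x.2.2.1; omega⟩
  unfold a
  exact Nat.card_of_isEmpty

theorem a_rec_zero (n : ℕ) : a 0 (n + 1) = ∑ p ∈ Finset.HasAntidiagonal.antidiagonal n, a 0 p.1 * a 0 p.2 := by
  rw [a_sum]
  refine Finset.sum_congr rfl fun p hp => ?_
  rw [Finset.HasAntidiagonal.mem_antidiagonal] at hp
  rw [a_zero_eq, a_zero_eq]
  refine card_fiber hp _ _ _ fun s t => ?_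
  rw [glue_av]
  exact and_iff_left (glue_beg_zero hp s t)

theorem a_rec_succ (k n : ℕ) : a (k + 1) (n + 1) =
    a k n + ∑ p ∈ Finset.HasAntidiagonal.antidiagonal n, a (k + 1) p.1 * a 0 p.2 := by
  rw [a_sum]
  have h0 : ((0, n) : ℕ × ℕ) ∈ Finset.HasAntidiagonal.antidiagonal n := by simp
  rw [← Finset.add_sum_erase _ _ h0, ← Finset.add_sum_erase _ _ h0, a_succ_zero, zero_mul, zero_add]
  congr 1
  · rw [card_fiber (i := 0) (j := n) (by omega) _ AvoidsC132
      (fun t => AvoidsC132 t ∧ BeginsDec t k), ← a_zero_eq, a_zero_zero, one_mul]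
    · rfl
    · intro s t
      rw [glue_av, glue_beg_empty _ _ _ rfl, and_assoc]
  · refine Finset.sum_congr rfl fun p hp => ?_
    rw [Finset.mem_erase, Finset.HasAntidiagonal.mem_antidiagonal] at hp
    obtain ⟨hne, hp⟩ := hp
    have hi : 0 < p.1 := by
      rcases Nat.eq_zero_or_pos p.1 with h | h
      · exact absurd (Prod.ext h (by simp only; omega)) hne
      · exact h
    rw [a_zero_eq, a]
    refine card_fiber hp _ _ _ fun s t => ?_
    rw [glue_av, glue_beg_pos hp s t hi]
    tauto

theorem a_zero_catalan (n : ℕ) : a 0 n = catalan n := by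
  induction n using Nat.strong_induction_on with
  | _ n ih =>
    cases n with
    | zero => rw [a_zero_zero, catalan_zero]
    | succ n =>
      rw [a_rec_zero, catalan_succ']
      refine Finset.sum_congr rfl fun p hp => ?_
      rw [Finset.HasAntidiagonal.mem_antidiagonal] at hp
      rw [ih p.1 (by omega), ih p.2 (by omega)]

theorem gf_zero : (PowerSeries.mk fun n => (catalan n : ℤ)) =
    1 + PowerSeries.X * ((PowerSeries.mk fun n => (catalan n : ℤ)) *
      (PowerSeries.mk fun n => (catalan n : ℤ))) := by
  ext n
  cases n with
  | zero => simp
  | succ n =>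
    rw [map_add, PowerSeries.coeff_succ_X_mul, PowerSeries.coeff_mul]
    simp [catalan_succ', PowerSeries.coeff_one]

theorem gf_succ (k : ℕ) : PowerSeries.mk (fun n => (a (k + 1) n : ℤ)) =
    PowerSeries.X * (PowerSeries.mk (fun n => (a k n : ℤ)) +
      PowerSeries.mk (fun n => (a (k + 1) n : ℤ)) * (PowerSeries.mk fun n => (catalan n : ℤ))) := by
  ext n
  cases n with
  | zero => simp [a_succ_zero]
  | succ n =>
    rw [PowerSeries.coeff_succ_X_mul, map_add, PowerSeries.coeff_mul]
    simp [a_rec_succ, a_zero_catalan]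

theorem gf_all (k : ℕ) :
    PowerSeries.mk (fun n => (a k n : ℤ))
      = PowerSeries.X ^ k * (PowerSeries.mk fun n => (catalan n : ℤ)) ^ (k + 1) := by
  induction k with
  | zero => simp [a_zero_catalan]
  | succ k ih =>
    have h1 := gf_succ k
    have h2 := gf_zero
    rw [ih] at h1
    generalize (PowerSeries.mk fun n => (catalan n : ℤ)) = C at *
    generalize (PowerSeries.mk fun n => (a (k + 1) n : ℤ)) = A at *
    linear_combination C * h1 - A * h2

theorem avoidC132_beginDec_gf (k : ℕ) (hk : 1 ≤ k) :
    PowerSeries.mk (fun n => (a k n : ℤ))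
      = PowerSeries.X ^ k * (PowerSeries.mk fun n => (catalan n : ℤ)) ^ (k + 1) := by
  exact gf_all k
end

section
/- For all n ≥ k ≥ 1, the number of permutations of length n that avoid the classical pattern 2-1-3 and begin with the pattern k(k-1)⋯1 equals the Catalan number C_{n-k+1}. -/
/-- `π` avoids the classical pattern 2-1-3: there are no indices `i < j < k`
with `π j < π i < π k`. -/
def AvoidsC213 {n : ℕ} (π : Equiv.Perm (Fin n)) : Prop :=
  ¬ ∃ i j k : Fin n, i < j ∧ j < k ∧ π j < π i ∧ π i < π k

theorem pw_of_forall {l : List ℕ} {R : ℕ → ℕ → Prop} (h : ∀ x ∈ l, ∀ y ∈ l, R x y) :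
    l.Pairwise R := by
  rw [List.pairwise_iff_getElem]
  intro i j hi hj _
  exact h _ (List.getElem_mem _) _ (List.getElem_mem _)

def AvL : List ℕ → Prop
  | [] => True
  | a :: l => l.Pairwise (fun b c => ¬ (b < a ∧ a < c)) ∧ AvL l

theorem AvL.append : ∀ {l₁ l₂ : List ℕ}, AvL l₁ → AvL l₂ → (∀ x ∈ l₁, ∀ y ∈ l₂, y < x) →
    AvL (l₁ ++ l₂)
  | [], _, _, h, _ => h
  | a :: l, l₂, h₁, h₂, h => by
    refine ⟨?_, AvL.append h₁.2 h₂ (fun x hx => h x (List.mem_cons_of_mem _ hx))⟩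
    have ha := h a List.mem_cons_self
    refine List.pairwise_append.2 ⟨h₁.1, ?_, ?_⟩
    · apply pw_of_forall
      intro x _ y hy hxy
      have := ha y hy
      omega
    · intro x _ y hy hxy
      have := ha y hy
      omega

theorem AvL.sublist {l₁ l₂ : List ℕ} (h : l₁.Sublist l₂) : AvL l₂ → AvL l₁ := by
  induction h with
  | slnil => exact id
  | cons a h ih => exact fun h2 => ih h2.2
  | cons_cons a h ih => exact fun h2 => ⟨h2.1.sublist h, ih h2.2⟩

theorem split_eq (a : ℕ) : ∀ l : List ℕ, l.Pairwise (fun b c => ¬ (b < a ∧ a < c)) → a ∉ l →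
    l.filter (fun x => a < x) ++ l.filter (fun x => x < a) = l
  | [], _, _ => rfl
  | b :: l, h, ha => by
    have ih := split_eq a l (List.pairwise_cons.1 h).2 (fun h => ha (List.mem_cons_of_mem _ h))
    have hb : a ≠ b := fun h => ha (h ▸ List.mem_cons_self)
    rcases lt_or_gt_of_ne hb with h1 | h1
    · simp [List.filter_cons, h1, not_lt.2 h1.le, ih]
    · have : ∀ c ∈ l, c < a := by
        intro c hc
        have := (List.pairwise_cons.1 h).1 c hc
        have : a ≠ c := fun h => ha (h ▸ List.mem_cons_of_mem _ hc)
        omega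
      have e1 : l.filter (fun x => a < x) = [] := by
        rw [List.filter_eq_nil_iff]
        intro c hc
        have := this c hc
        simp; omega
      have e2 : l.filter (fun x => x < a) = l := by
        rw [List.filter_eq_self]
        intro c hc
        simpa using this c hc
      simp [List.filter_cons, h1, not_lt.2 h1.le, e1, e2]

def treeList : BinaryTree Unit → ℕ → List ℕ
  | .nil, _ => []
  | .node _ l r, o => (o + r.numNodes) :: (treeList l (o + r.numNodes + 1) ++ treeList r o)

theorem treeList_length : ∀ (t : BinaryTree Unit) (o : ℕ), (treeList t o).length = t.numNodes
  | .nil, _ => rfl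
  | .node _ l r, o => by
    simp [treeList, treeList_length l, treeList_length r, BinaryTree.numNodes]

theorem treeList_inj : ∀ (t t' : BinaryTree Unit) (o : ℕ), treeList t o = treeList t' o → t = t'
  | .nil, .nil, _, _ => rfl
  | .nil, .node _ _ _, _, h => by simp [treeList] at h
  | .node _ _ _, .nil, _, h => by simp [treeList] at h
  | .node _ l r, .node _ l' r', o, h => by
    simp only [treeList, List.cons.injEq] at h
    obtain ⟨h1, h2⟩ := h
    have hr : r.numNodes = r'.numNodes := by omega
    rw [hr] at h2
    have := List.append_inj' h2 (by simp [treeList_length, hr])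
    rw [treeList_inj l l' _ this.1, treeList_inj r r' _ this.2]

theorem treeList_mem : ∀ (t : BinaryTree Unit) (o x : ℕ),
    x ∈ treeList t o ↔ o ≤ x ∧ x < o + t.numNodes
  | .nil, _, _ => by simp [treeList, BinaryTree.numNodes]
  | .node _ l r, o, x => by
    simp [treeList, treeList_mem l, treeList_mem r, BinaryTree.numNodes]
    omega

theorem treeList_nodup : ∀ (t : BinaryTree Unit) (o : ℕ), (treeList t o).Nodup
  | .nil, _ => by simp [treeList]
  | .node _ l r, o => by
    simp only [treeList, List.nodup_cons, List.nodup_append, List.mem_append, treeList_mem]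
    refine ⟨by omega, treeList_nodup l _, treeList_nodup r _, ?_⟩
    intros; omega

theorem treeList_av : ∀ (t : BinaryTree Unit) (o : ℕ), AvL (treeList t o)
  | .nil, _ => trivial
  | .node _ l r, o => by
    refine ⟨?_, AvL.append (treeList_av l _) (treeList_av r _) ?_⟩
    · rw [List.pairwise_append]
      refine ⟨?_, ?_, ?_⟩
      · apply pw_of_forall
        simp only [treeList_mem]; intros; omega
      · apply pw_of_forall
        simp only [treeList_mem]; intros; omega
      · simp only [treeList_mem]; intros; omega
    · simp only [treeList_mem]; intros; omega

theorem len_of_mem {l : List ℕ} {o n : ℕ} (hd : l.Nodup) (hm : ∀ x, x ∈ l ↔ o ≤ x ∧ x < o + n) :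
    l.length = n := by
  have : l.Perm (List.range' o n) := by
    rw [List.perm_ext_iff_of_nodup hd List.nodup_range']
    intro x; rw [hm]; simp [List.mem_range'_1]
  simpa using this.length_eq

theorem treeList_surj (n : ℕ) : ∀ (o : ℕ) (l : List ℕ), l.Nodup →
    (∀ x, x ∈ l ↔ o ≤ x ∧ x < o + n) → AvL l → ∃ t, treeList t o = l := by
  induction n using Nat.strong_induction_on with
  | _ n ih =>
    intro o l hd hm hav
    match l, hd, hm, hav with
    | [], _, _, _ => exact ⟨.nil, rfl⟩
    | a :: l, hd, hm, hav =>
      have ha := (hm a).1 List.mem_cons_self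
      have hd' := List.nodup_cons.1 hd
      have hs := split_eq a l hav.1 hd'.1
      have hm' : ∀ x, x ∈ l ↔ o ≤ x ∧ x < o + n ∧ x ≠ a := by
        intro x
        have := hm x
        rw [List.mem_cons] at this
        have h3 : x ∈ l → x ≠ a := fun h h' => hd'.1 (h' ▸ h)
        tauto
      have d1 := hd'.2.filter (fun x => a < x)
      have d2 := hd'.2.filter (fun x => x < a)
      have m1 : ∀ x, x ∈ l.filter (fun x => a < x) ↔ a + 1 ≤ x ∧ x < (a + 1) + (o + n - a - 1) := by
        intro x
        simp only [List.mem_filter, hm', decide_eq_true_eq]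
        omega
      have m2 : ∀ x, x ∈ l.filter (fun x => x < a) ↔ o ≤ x ∧ x < o + (a - o) := by
        intro x
        simp only [List.mem_filter, hm', decide_eq_true_eq]
        omega
      obtain ⟨t1, h1⟩ := ih (o + n - a - 1) (by omega) _ _ d1 m1 (hav.2.sublist List.filter_sublist)
      obtain ⟨t2, h2⟩ := ih (a - o) (by omega) _ _ d2 m2 (hav.2.sublist List.filter_sublist)
      have hl : t2.numNodes = a - o := by
        rw [← treeList_length t2 o, h2]
        exact len_of_mem d2 m2
      refine ⟨.node () t1 t2, ?_⟩
      have e : o + t2.numNodes = a := by omega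
      simp only [treeList, e]
      rw [h1, h2, hs]

def LS (n k : ℕ) : Set (List ℕ) :=
  {l | l.Nodup ∧ (∀ x, x ∈ l ↔ x < n) ∧ AvL l ∧ (l.take k).Pairwise (fun a b => b < a)}

theorem LS_one (n : ℕ) : (LS n 1).ncard = catalan n := by
  have : LS n 1 = (fun t => treeList t 0) '' (BinaryTree.treesOfNumNodesEq n : Set (BinaryTree Unit)) := by
    ext l
    simp only [LS, Set.mem_ofPred_eq, Set.mem_image, Finset.mem_coe, BinaryTree.mem_treesOfNumNodesEq]
    constructor
    · rintro ⟨h1, h2, h3, -⟩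
      have h2' : ∀ x, x ∈ l ↔ 0 ≤ x ∧ x < 0 + n := by simpa using h2
      obtain ⟨t, ht⟩ := treeList_surj n 0 l h1 h2' h3
      refine ⟨t, ?_, ht⟩
      rw [← treeList_length t 0, ht]
      exact len_of_mem h1 h2'
    · rintro ⟨t, ht, rfl⟩
      refine ⟨treeList_nodup _ _, ?_, treeList_av _ _, ?_⟩
      · simp [treeList_mem, ht]
      · cases treeList t 0 <;> simp
  rw [this, Set.ncard_image_of_injective _ (fun a b h => treeList_inj a b 0 h),
    Set.ncard_coe_finset, BinaryTree.treesOfNumNodesEq_card_eq_catalan]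

theorem LS_succ (n k : ℕ) (hk : 1 ≤ k) : (LS (n + 1) (k + 1)).ncard = (LS n k).ncard := by
  have : LS (n + 1) (k + 1) = (fun l => n :: l) '' LS n k := by
    ext l
    simp only [LS, Set.mem_ofPred_eq, Set.mem_image]
    constructor
    · rintro ⟨h1, h2, h3, h4⟩
      match l, h1, h2, h3, h4 with
      | [], _, h2, _, _ => exact absurd ((h2 0).2 (by omega)) (by simp)
      | a :: l, h1, h2, h3, h4 =>
        have hd := List.nodup_cons.1 h1
        rw [List.take_succ_cons, List.pairwise_cons] at h4
        have han : a = n := by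
          by_contra hne
          have haN := (h2 a).1 List.mem_cons_self
          have hn : n ∈ l := by
            have := (h2 n).2 (by omega)
            rw [List.mem_cons] at this
            exact this.resolve_left (Ne.symm hne)
          match l, h3, h4, hn with
          | b :: l, h3, h4, hn =>
            obtain ⟨k, rfl⟩ : ∃ k', k = k' + 1 := ⟨k - 1, by omega⟩
            have hb := h4.1 b (by simp)
            rcases List.mem_cons.1 hn with h | h
            · omega
            · exact (List.pairwise_cons.1 h3.1).1 n h ⟨hb, by omega⟩
        subst han
        refine ⟨l, ⟨hd.2, ?_, h3.2, h4.2⟩, rfl⟩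
        intro x
        have h5 := h2 x
        rw [List.mem_cons] at h5
        have h3 : x ∈ l → x ≠ a := fun h h' => hd.1 (h' ▸ h)
        constructor
        · intro h
          have := h3 h
          have := h5.1 (Or.inr h)
          omega
        · intro h
          exact (h5.2 (by omega)).resolve_left (by omega)
    · rintro ⟨l, ⟨h1, h2, h3, h4⟩, rfl⟩
      refine ⟨List.nodup_cons.2 ⟨by simp [h2], h1⟩, ?_, ⟨?_, h3⟩, ?_⟩
      · intro x
        rw [List.mem_cons, h2]; omega
      · apply pw_of_forall
        simp only [h2]; intros; omega
      · rw [List.take_succ_cons, List.pairwise_cons]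
        exact ⟨fun x hx => (h2 x).1 (List.mem_of_mem_take hx), h4⟩
  rw [this, Set.ncard_image_of_injective]
  intro a b h
  simpa using h

theorem LS_card (m k : ℕ) : (LS (m + k) (k + 1)).ncard = catalan (m) := by
  induction k with
  | zero => exact LS_one m
  | succ k ih => rw [← ih, ← add_assoc, LS_succ _ _ (by omega)]

theorem AvL_iff : ∀ l : List ℕ, AvL l ↔ ∀ i j k (_ : i < j) (_ : j < k) (hk : k < l.length),
    ¬ (l[j] < l[i] ∧ l[i] < l[k])
  | [] => by simp [AvL]
  | a :: l => by
    rw [AvL, AvL_iff l, List.pairwise_iff_getElem]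
    constructor
    · rintro ⟨h1, h2⟩ i j k hij hjk hk
      obtain ⟨j, rfl⟩ : ∃ j', j = j' + 1 := ⟨j - 1, by omega⟩
      obtain ⟨k, rfl⟩ : ∃ j', k = j' + 1 := ⟨k - 1, by omega⟩
      simp only [List.length_cons] at hk
      cases i with
      | zero => simpa using h1 j k (by omega) (by omega) (by omega)
      | succ i => simpa using h2 i j k (by omega) (by omega) (by omega)
    · intro h
      constructor
      · intro j k hj hk hjk
        exact h 0 (j + 1) (k + 1) (by omega) (by omega) (by simpa using hk)
      · intro i j k hij hjk hk
        exact h (i + 1) (j + 1) (k + 1) (by omega) (by omega) (by simpa using hk)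

def toL {n : ℕ} (π : Equiv.Perm (Fin n)) : List ℕ := List.ofFn (fun i => (π i : ℕ))

theorem toL_mem {n k : ℕ} (hkn : k ≤ n) (π : Equiv.Perm (Fin n)) :
    toL π ∈ LS n k ↔ AvoidsC213 π ∧ BeginsDec π k := by
  have e1 : (toL π).Nodup := by
    rw [toL, List.nodup_ofFn]
    exact Fin.val_injective.comp π.injective
  have e2 : ∀ x, x ∈ toL π ↔ x < n := by
    intro x
    rw [toL, List.mem_ofFn]
    constructor
    · rintro ⟨i, rfl⟩; exact (π i).2
    · intro h; exact ⟨π.symm ⟨x, h⟩, by simp⟩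
  have e3 : AvL (toL π) ↔ AvoidsC213 π := by
    rw [AvL_iff]
    constructor
    · rintro h ⟨i, j, k, hij, hjk, h1, h2⟩
      have := h i j k hij hjk (by simp [toL])
      apply this
      simpa [toL] using ⟨h1, h2⟩
    · intro h i j k hij hjk hk h'
      have hk' : k < n := by simpa [toL] using hk
      refine h ⟨⟨i, by omega⟩, ⟨j, by omega⟩, ⟨k, hk'⟩, hij, hjk, ?_⟩
      simpa [toL] using h'
  have e4 : ((toL π).take k).Pairwise (fun a b => b < a) ↔ BeginsDec π k := by
    rw [List.pairwise_iff_getElem]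
    constructor
    · intro h
      refine ⟨hkn, fun i j hij hj => ?_⟩
      simpa [toL] using h i j (by simp [toL]; omega) (by simp [toL]; omega) hij
    · rintro ⟨-, h⟩ i j hi hj hij
      simp [toL] at hi hj
      simpa [toL] using h ⟨i, hi.2⟩ ⟨j, hj.2⟩ hij hj.1
  simp only [LS, Set.mem_ofPred_eq, e3, e4]
  exact ⟨fun h => h.2.2, fun h => ⟨e1, e2, h⟩⟩

theorem toL_inj {n : ℕ} : Function.Injective (toL (n := n)) := by
  intro π σ h
  have := List.ofFn_injective h
  ext i
  exact congrFun this i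

theorem toL_surj {n k : ℕ} {l : List ℕ} (h : l ∈ LS n k) : ∃ π : Equiv.Perm (Fin n), toL π = l := by
  obtain ⟨h1, h2, -⟩ := h
  have hl : l.length = n := len_of_mem (o := 0) h1 (by simpa using h2)
  subst hl
  let f : Fin l.length → Fin l.length := fun i => ⟨l.get i, (h2 _).1 (List.get_mem _ _)⟩
  have hf : Function.Injective f := by
    intro i j hij
    exact List.nodup_iff_injective_get.1 h1 (by simpa [f] using hij)
  refine ⟨Equiv.ofBijective f (Finite.injective_iff_bijective.1 hf), ?_⟩
  simp [toL, f]

theorem avoidC213_beginDec_count (n k : ℕ) (hk : 1 ≤ k) (hkn : k ≤ n) :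
    Nat.card {π : Equiv.Perm (Fin n) // AvoidsC213 π ∧ BeginsDec π k}
      = catalan (n - k + 1) := by
  have h1 : toL '' {π : Equiv.Perm (Fin n) | AvoidsC213 π ∧ BeginsDec π k} = LS n k := by
    ext l
    constructor
    · rintro ⟨π, hπ, rfl⟩
      exact (toL_mem hkn π).2 hπ
    · intro h
      obtain ⟨π, rfl⟩ := toL_surj h
      exact ⟨π, (toL_mem hkn π).1 h, rfl⟩
  have h2 := Set.ncard_image_of_injective
    {π : Equiv.Perm (Fin n) | AvoidsC213 π ∧ BeginsDec π k} toL_inj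
  rw [h1] at h2
  have h3 := LS_card (n - k + 1) (k - 1)
  rw [show n - k + 1 + (k - 1) = n by omega, show k - 1 + 1 = k by omega] at h3
  rw [← h3, h2]
  rfl
end

section
/- For all n ≥ 1 and 1 ≤ t ≤ n, the number of permutations of length n that avoid the classical pattern 1-2-3 and whose first letter is t equals ∑_{j=0}^{n-t} (-1)^j · binom(n-t-j, j) · C_{n-1-j} (an identity of integers, where binom(a,b) = 0 when b > a). -/
/-- `π` avoids the classical pattern 1-2-3: there are no indices `i < j < k`
with `π i < π j < π k`. -/
def AvoidsC123 {n : ℕ} (π : Equiv.Perm (Fin n)) : Prop :=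
  ¬ ∃ i j k : Fin n, i < j ∧ j < k ∧ π i < π j ∧ π j < π k

def consFun {n : ℕ} (p : Fin (n+1)) (σ : Equiv.Perm (Fin n)) : Fin (n+1) → Fin (n+1) :=
  Fin.cons p (fun i => p.succAbove (σ i))

theorem consFun_inj {n : ℕ} (p : Fin (n+1)) (σ : Equiv.Perm (Fin n)) :
    Function.Injective (consFun p σ) := by
  unfold consFun
  rw [Fin.cons_injective_iff]
  refine ⟨?_, ?_⟩
  · rintro ⟨i, hi⟩
    exact Fin.succAbove_ne _ _ hi
  · intro i j h
    exact σ.injective (Fin.succAbove_right_injective h)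

noncomputable def consPerm {n : ℕ} (x : Fin (n+1) × Equiv.Perm (Fin n)) :
    Equiv.Perm (Fin (n+1)) :=
  Equiv.ofBijective (consFun x.1 x.2) (Finite.injective_iff_bijective.1 (consFun_inj x.1 x.2))

theorem consPerm_zero {n : ℕ} (x : Fin (n+1) × Equiv.Perm (Fin n)) : consPerm x 0 = x.1 := rfl
theorem consPerm_succ {n : ℕ} (x : Fin (n+1) × Equiv.Perm (Fin n)) (i : Fin n) :
    consPerm x i.succ = x.1.succAbove (x.2 i) := rfl

theorem consPerm_bij (n : ℕ) : Function.Bijective (@consPerm n) := by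
  rw [Fintype.bijective_iff_injective_and_card]
  constructor
  · rintro ⟨p, σ⟩ ⟨q, τ⟩ h
    have h0 : p = q := by
      have := congrArg (fun e => e 0) h
      simpa [consPerm_zero] using this
    subst h0
    congr 1
    ext i : 1
    have := congrArg (fun e => e i.succ) h
    simpa [consPerm_succ] using this
  · simp [Fintype.card_perm, Nat.factorial_succ]

noncomputable def consEquiv (n : ℕ) :
    Fin (n+1) × Equiv.Perm (Fin n) ≃ Equiv.Perm (Fin (n+1)) :=
  Equiv.ofBijective _ (consPerm_bij n)

def GP {n : ℕ} (k : ℕ) (σ : Equiv.Perm (Fin n)) : Prop :=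
  AvoidsC123 σ ∧ ∀ i j : Fin n, i < j → σ i < σ j → (σ i : ℕ) < k

theorem succAbove_val_gt {n : ℕ} (p : Fin (n+1)) (a : Fin n) :
    p < p.succAbove a ↔ (p : ℕ) ≤ a := by
  rw [Fin.lt_succAbove_iff_le_castSucc]; simp [Fin.le_def]

theorem avoid_cons {n : ℕ} (x : Fin (n+1) × Equiv.Perm (Fin n)) :
    AvoidsC123 (consPerm x) ↔ GP (x.1 : ℕ) x.2 := by
  unfold GP AvoidsC123
  constructor
  · intro h
    refine ⟨?_, ?_⟩
    · rintro ⟨i, j, k, hij, hjk, h1, h2⟩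
      refine h ⟨i.succ, j.succ, k.succ, by simpa, by simpa, ?_, ?_⟩ <;>
        simpa [consPerm_succ, Fin.succAbove_lt_succAbove_iff]
    · intro i j hij h1
      by_contra hc
      refine h ⟨0, i.succ, j.succ, Fin.succ_pos _, by simpa, ?_, ?_⟩
      · rw [consPerm_succ, consPerm_zero, succAbove_val_gt]; omega
      · simpa [consPerm_succ, Fin.succAbove_lt_succAbove_iff]
  · rintro ⟨h, h'⟩ ⟨i, j, k, hij, hjk, h1, h2⟩
    obtain ⟨j, rfl⟩ := Fin.exists_succ_eq.2 (Fin.ne_zero_of_lt hij)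
    obtain ⟨k, rfl⟩ := Fin.exists_succ_eq.2 (Fin.ne_zero_of_lt hjk)
    simp only [Fin.succ_lt_succ_iff, consPerm_succ, Fin.succAbove_lt_succAbove_iff] at hjk h2
    rcases Fin.eq_zero_or_eq_succ i with rfl | ⟨i, rfl⟩
    · rw [consPerm_succ, consPerm_zero, succAbove_val_gt] at h1
      have := h' j k hjk h2
      omega
    · simp only [Fin.succ_lt_succ_iff, consPerm_succ, Fin.succAbove_lt_succAbove_iff] at hij h1
      exact h ⟨i, j, k, hij, hjk, h1, h2⟩

theorem GP_mono {n k l : ℕ} (h : k ≤ l) (σ : Equiv.Perm (Fin n)) (hk : GP k σ) : GP l σ :=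
  ⟨hk.1, fun i j a b => lt_of_lt_of_le (hk.2 i j a b) h⟩

theorem GP_cons_lt {n k : ℕ} (s : Fin (n+1)) (τ : Equiv.Perm (Fin n)) (hs : (s : ℕ) < k) :
    GP k (consPerm (s, τ)) ↔ GP (s : ℕ) τ := by
  constructor
  · intro h; exact (avoid_cons _).1 h.1
  · intro h
    refine ⟨(avoid_cons _).2 h, ?_⟩
    intro i j hij h1
    obtain ⟨j, rfl⟩ := Fin.exists_succ_eq.2 (Fin.ne_zero_of_lt hij)
    rcases Fin.eq_zero_or_eq_succ i with rfl | ⟨i, rfl⟩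
    · exact hs
    · simp only [Fin.succ_lt_succ_iff, consPerm_succ, Fin.succAbove_lt_succAbove_iff] at hij h1
      have := h.2 i j hij h1
      have h3 : ¬ (s < s.succAbove (τ i)) := by rw [succAbove_val_gt]; omega
      rw [consPerm_succ]
      show ((s.succAbove (τ i) : Fin (n+1)) : ℕ) < k
      rw [Fin.lt_def] at h3
      omega

theorem GP_cons_last {n k : ℕ} (τ : Equiv.Perm (Fin n)) (hk : k ≤ n) :
    GP k (consPerm (Fin.last n, τ)) ↔ GP k τ := by
  constructor
  · intro h
    refine ⟨((avoid_cons _).1 h.1).1, ?_⟩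
    intro i j hij h1
    have := h.2 i.succ j.succ (by simpa) (by simpa [consPerm_succ])
    simpa [consPerm_succ] using this
  · intro h
    refine ⟨(avoid_cons _).2 (GP_mono (by simpa) _ h), ?_⟩
    intro i j hij h1
    obtain ⟨j, rfl⟩ := Fin.exists_succ_eq.2 (Fin.ne_zero_of_lt hij)
    rcases Fin.eq_zero_or_eq_succ i with rfl | ⟨i, rfl⟩
    · rw [consPerm_zero] at h1
      exact absurd h1 (not_lt.2 (Fin.le_last _))
    · simp only [Fin.succ_lt_succ_iff, consPerm_succ, Fin.succAbove_lt_succAbove_iff] at hij h1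
      simpa [consPerm_succ] using h.2 i j hij h1

theorem GP_cons_mid {n k : ℕ} (s : Fin (n+1)) (τ : Equiv.Perm (Fin n)) (hk : k ≤ s)
    (hs : (s : ℕ) < n) : ¬ GP k (consPerm (s, τ)) := by
  intro h
  obtain ⟨j, hj⟩ := (consPerm (s, τ)).surjective (Fin.last n)
  have hlt : consPerm (s, τ) 0 < consPerm (s, τ) j := by
    rw [hj, consPerm_zero, Fin.lt_def]; simpa
  have hj0 : 0 < j := by
    rw [Fin.pos_iff_ne_zero]; rintro rfl; exact lt_irrefl _ hlt
  have := h.2 0 j hj0 hlt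
  rw [consPerm_zero] at this
  simp only at this
  omega

noncomputable def gc (n k : ℕ) : ℕ := Nat.card {σ : Equiv.Perm (Fin n) // GP k σ}

theorem gc_succ (n k : ℕ) (hk : k ≤ n + 1) :
    gc (n+1) k = ∑ s ∈ Finset.range (n+1),
      (if s < k then gc n s else if s = n then gc n k else 0) := by
  classical
  have e1 : gc (n+1) k = Nat.card {x : Fin (n+1) × Equiv.Perm (Fin n) // GP k (consPerm x)} :=
    Nat.card_congr ((consEquiv n).subtypeEquiv (fun x => Iff.rfl)).symm
  have e2 : Nat.card {x : Fin (n+1) × Equiv.Perm (Fin n) // GP k (consPerm x)}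
      = Nat.card (Σ s : Fin (n+1), {τ : Equiv.Perm (Fin n) // GP k (consPerm (s, τ))}) :=
    Nat.card_congr
      { toFun := fun x => ⟨x.1.1, x.1.2, x.2⟩
        invFun := fun y => ⟨(y.1, y.2.1), y.2.2⟩
        left_inv := fun _ => rfl
        right_inv := fun _ => rfl }
  rw [e1, e2, Nat.card_sigma, ← Fin.sum_univ_eq_sum_range
    (fun s => if s < k then gc n s else if s = n then gc n k else 0)]
  refine Finset.sum_congr rfl fun s _ => ?_
  have hsn := s.2
  split_ifs with h1 h2
  · exact Nat.card_congr (Equiv.subtypeEquivRight fun τ => GP_cons_lt s τ h1)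
  · have : s = Fin.last n := Fin.ext h2
    subst this
    exact Nat.card_congr (Equiv.subtypeEquivRight fun τ => GP_cons_last τ (by simpa using h1))
  · have : IsEmpty {τ : Equiv.Perm (Fin n) // GP k (consPerm (s, τ))} :=
      ⟨fun τ => GP_cons_mid s τ.1 (by omega) (by omega) τ.2⟩
    exact Nat.card_of_isEmpty

theorem gc_succ' (n k : ℕ) (hk : k ≤ n) :
    gc (n+1) k = ∑ s ∈ Finset.range (k+1), gc n s := by
  rw [gc_succ n k (by omega), Finset.sum_range_succ, Finset.sum_range_succ, if_neg (by omega),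
    if_pos rfl]
  congr 1
  rw [← Finset.sum_filter_add_sum_filter_not _ (fun s => s < k), Finset.sum_congr rfl
    (g := fun s => gc n s) (fun s hs => if_pos (Finset.mem_filter.1 hs).2),
    Finset.sum_eq_zero (s := Finset.filter (fun s => ¬ s < k) _), add_zero]
  · congr 1; ext s; simp; omega
  · intro s hs
    simp only [Finset.mem_filter, Finset.mem_range] at hs
    rw [if_neg hs.2, if_neg (by omega)]

theorem gc_succ_last (n : ℕ) : gc (n+1) (n+1) = ∑ s ∈ Finset.range (n+1), gc n s := by
  rw [gc_succ n (n+1) le_rfl]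
  exact Finset.sum_congr rfl fun s hs => if_pos (Finset.mem_range.1 hs)

def BB (n : ℕ) : ℕ → ℤ
  | 0 => 1
  | k+1 => (Nat.choose (n+k+1) (k+1) : ℤ) - Nat.choose (n+k+1) k

theorem BB_rec (n k : ℕ) : BB (n+1) (k+1) = BB (n+1) k + BB n (k+1) := by
  cases k with
  | zero => simp [BB]; ring
  | succ k =>
    simp only [BB]
    have h1 : Nat.choose (n+1+(k+1)+1) (k+1+1) = Nat.choose (n+1+k+1) (k+1)
      + Nat.choose (n+(k+1)+1) (k+1+1) := by
      rw [show n+(k+1)+1 = n+1+k+1 by ring, ← Nat.choose_succ_succ]; rfl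
    have h2 : Nat.choose (n+1+(k+1)+1) (k+1) = Nat.choose (n+1+k+1) k
      + Nat.choose (n+(k+1)+1) (k+1) := by
      rw [show n+(k+1)+1 = n+1+k+1 by ring, ← Nat.choose_succ_succ]; rfl
    rw [h1, h2]; push_cast; ring

theorem BB_zero' (n : ℕ) : BB n (n+1) = 0 := by
  simp only [BB]
  rw [Nat.choose_symm_of_eq_add (show n+n+1 = (n+1)+n by ring)]; simp

theorem BB_last (n : ℕ) : BB (n+1) (n+1) = BB (n+1) n := by
  rw [BB_rec, BB_zero', add_zero]

theorem BB_sum (n k : ℕ) : ∑ s ∈ Finset.range (k+1), BB n s = BB (n+1) k := by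
  induction k with
  | zero => simp [BB]
  | succ k ih => rw [Finset.sum_range_succ, ih, BB_rec]

theorem BB_catalan (n : ℕ) : BB n n = catalan n := by
  cases n with
  | zero => simp [BB]
  | succ n =>
    have h := succ_mul_catalan_eq_centralBinom (n+1)
    have h2 := Nat.choose_succ_right_eq (2*(n+1)) n
    rw [Nat.centralBinom] at h
    simp only [BB]
    rw [show n+1+n+1 = 2*(n+1) by ring]
    rw [show 2*(n+1)-n = n+2 by omega] at h2
    zify at h h2
    have : ((n:ℤ)+2) ≠ 0 := by positivity
    apply mul_left_cancel₀ this
    push_cast at h h2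
    linear_combination -h + h2

theorem gc_eq (n : ℕ) : ∀ k, k ≤ n → (gc n k : ℤ) = BB n k := by
  induction n with
  | zero =>
    intro k hk
    obtain rfl : k = 0 := by omega
    have : ∀ σ : Equiv.Perm (Fin 0), GP 0 σ := fun σ =>
      ⟨fun ⟨i, _⟩ => i.elim0, fun i => i.elim0⟩
    simp [gc, this, BB]
  | succ n ih =>
    have main : ∀ k, k ≤ n → (gc (n+1) k : ℤ) = BB (n+1) k := by
      intro k hk
      rw [gc_succ' n k hk, ← BB_sum]
      push_cast
      exact Finset.sum_congr rfl fun s hs => ih s (by have := Finset.mem_range.1 hs; omega)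
    intro k hk
    rcases Nat.lt_or_ge n k with h | h
    · obtain rfl : k = n + 1 := by omega
      rw [gc_succ_last, ← gc_succ' n n le_rfl, main n le_rfl, BB_last]
    · exact main k h

def SS (m d : ℕ) : ℤ := ∑ j ∈ Finset.range (d + 1),
  (-1 : ℤ) ^ j * (Nat.choose (d - j) j : ℤ) * (catalan (m - j) : ℤ)

theorem SS_rec (m d : ℕ) : SS (m+1) (d+2) = SS (m+1) (d+1) - SS m d := by
  unfold SS
  rw [Finset.sum_range_succ' _ (d+2), Finset.sum_range_succ _ (d+1), Finset.sum_range_succ' _ (d+1)]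
  have hz : Nat.choose (d + 2 - (d+1+1)) (d+1+1) = 0 := by simp
  rw [hz]
  have : ∀ j ∈ Finset.range (d+1),
      (-1 : ℤ) ^ (j+1) * (Nat.choose (d + 2 - (j+1)) (j+1) : ℤ) * (catalan (m + 1 - (j+1)) : ℤ)
      = (-1 : ℤ) ^ (j+1) * (Nat.choose (d + 1 - (j+1)) (j+1) : ℤ) * (catalan (m + 1 - (j+1)) : ℤ)
       - (-1 : ℤ) ^ j * (Nat.choose (d - j) j : ℤ) * (catalan (m - j) : ℤ) := by
    intro j hj
    have hj := Finset.mem_range.1 hj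
    rw [show d + 2 - (j+1) = (d - j) + 1 by omega, show d + 1 - (j+1) = d - j by omega,
      show m + 1 - (j+1) = m - j by omega, Nat.choose_succ_succ]
    push_cast
    ring
  rw [Finset.sum_congr rfl this, Finset.sum_sub_distrib]
  simp
  ring

theorem BB_SS (d : ℕ) : ∀ k, BB (k+d) k = SS (k+d) d := by
  induction d using Nat.strong_induction_on with
  | _ d ih =>
    intro k
    match d with
    | 0 => simp [SS, BB_catalan]
    | 1 =>
      rw [← BB_last, BB_catalan]; simp [SS, Finset.sum_range_succ]
    | d+2 =>
      have h1 := ih (d+1) (by omega) (k+1)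
      have h2 := ih d (by omega) (k+1)
      have h3 := SS_rec (k+1+d) d
      have h4 := BB_rec (k+1+d) k
      rw [show k+1+(d+1) = k+1+d+1 by ring] at h1
      rw [show k+(d+2) = k+1+d+1 by ring]
      linarith

theorem avoidC123_firstLetter_count (n t : ℕ) (hn : 1 ≤ n) (ht : 1 ≤ t) (htn : t ≤ n) :
    (Nat.card {π : Equiv.Perm (Fin n) //
        AvoidsC123 π ∧ ∃ h : 0 < n, ((π ⟨0, h⟩ : Fin n) : ℕ) + 1 = t} : ℤ)
      = ∑ j ∈ Finset.range (n - t + 1),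
          (-1 : ℤ) ^ j * (Nat.choose (n - t - j) j : ℤ) * (catalan (n - 1 - j) : ℤ) := by
  obtain ⟨k, rfl⟩ : ∃ k, t = k + 1 := ⟨t - 1, by omega⟩
  obtain ⟨d, rfl⟩ : ∃ d, n = k + d + 1 := ⟨n - (k + 1), by omega⟩
  have hR := BB_SS d k
  unfold SS at hR
  rw [show k + d + 1 - (k + 1) = d by omega, show k + d + 1 - 1 = k + d by omega, ← hR,
    ← gc_eq _ _ (by omega)]
  congr 1
  symm
  unfold gc
  refine Nat.card_congr (Equiv.ofBijective (fun τ => ⟨consPerm (⟨k, by omega⟩, τ.1),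
    (avoid_cons _).2 τ.2, by omega, rfl⟩) ⟨?_, ?_⟩)
  · intro a b h
    have h' := (consPerm_bij (k+d)).1 (congrArg Subtype.val h)
    exact Subtype.ext (congrArg Prod.snd h')
  · rintro ⟨π, h1, h2, h3⟩
    have hk : k < k + d + 1 := by clear h3; omega
    obtain ⟨⟨p, τ⟩, rfl⟩ := (consPerm_bij (k+d)).2 π
    have hp : p = ⟨k, hk⟩ := by
      apply Fin.ext
      have : (p : ℕ) + 1 = k + 1 := h3
      simpa using this
    subst hp
    exact ⟨⟨τ, (avoid_cons _).1 h1⟩, rfl⟩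
end

section
/- For all k ≥ 1, ℓ ≥ 1 and n ≥ k+ℓ-1, the number of permutations of length n that avoid the classical pattern 1-3-2, begin with the pattern 12⋯k, and end with the pattern ℓ(ℓ-1)⋯1 equals the Catalan number C_{n-k-ℓ+2}; moreover this number is 0 for n < k+ℓ-1. -/
/-- `π` begins with the pattern `12⋯k`: its first `k` letters are increasing
(in particular the length is at least `k`). -/
def BeginsInc {n : ℕ} (π : Equiv.Perm (Fin n)) (k : ℕ) : Prop :=
  k ≤ n ∧ ∀ i j : Fin n, i < j → (j : ℕ) < k → π i < π j

/-- `π` ends with the pattern `ℓ(ℓ-1)⋯1`: its last `ℓ` letters are decreasing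
(in particular the length is at least `ℓ`). -/
def EndsDec {n : ℕ} (π : Equiv.Perm (Fin n)) (l : ℕ) : Prop :=
  l ≤ n ∧ ∀ i j : Fin n, i < j → n - l ≤ (i : ℕ) → π j < π i

def pins {n : ℕ} (p v : Fin (n+1)) (σ : Equiv.Perm (Fin n)) : Equiv.Perm (Fin (n+1)) :=
  (finSuccEquiv' p).trans ((Equiv.optionCongr σ).trans (finSuccEquiv' v).symm)

theorem pins_self {n : ℕ} (p v : Fin (n+1)) (σ : Equiv.Perm (Fin n)) : pins p v σ p = v := by
  simp [pins]

theorem pins_above {n : ℕ} (p v : Fin (n+1)) (σ : Equiv.Perm (Fin n)) (i : Fin n) :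
    pins p v σ (p.succAbove i) = v.succAbove (σ i) := by
  simp [pins]

theorem pins_inj {n : ℕ} (p v w : Fin (n+1)) (σ τ : Equiv.Perm (Fin n))
    (h : pins p v σ = pins p w τ) : σ = τ := by
  have hv : v = w := by rw [← pins_self p v σ, h, pins_self]
  subst hv
  ext i
  have := congrArg (fun e => e (p.succAbove i)) h
  simp only [pins_above] at this
  rw [Fin.succAbove_right_injective this]

theorem pins_surj {n : ℕ} (p : Fin (n+1)) (π : Equiv.Perm (Fin (n+1))) :
    ∃ σ, π = pins p (π p) σ := by
  have h : ∀ i : Fin n, ∃ j : Fin n, (π p).succAbove j = π (p.succAbove i) := by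
    intro i
    apply Fin.exists_succAbove_eq
    intro h
    exact Fin.succAbove_ne p i (π.injective h)
  choose f hf using h
  have hinj : Function.Injective f := by
    intro a b hab
    have : π (p.succAbove a) = π (p.succAbove b) := by rw [← hf, ← hf, hab]
    exact Fin.succAbove_right_injective (π.injective this)
  refine ⟨Equiv.ofBijective f (Finite.injective_iff_bijective.mp hinj), ?_⟩
  apply Equiv.ext
  intro x
  by_cases hx : x = p
  · subst hx; rw [pins_self]
  · obtain ⟨i, rfl⟩ := Fin.exists_succAbove_eq hx
    rw [pins_above, ← hf]; rfl

theorem pins0_zero {n : ℕ} (v : Fin (n+1)) (σ : Equiv.Perm (Fin n)) : pins 0 v σ 0 = v :=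
  pins_self _ _ _

theorem pins0_succ {n : ℕ} (v : Fin (n+1)) (σ : Equiv.Perm (Fin n)) (i : Fin n) :
    pins 0 v σ i.succ = v.succAbove (σ i) := by
  rw [← pins_above, Fin.succAbove_zero]

theorem pinsL_last {n : ℕ} (σ : Equiv.Perm (Fin n)) : pins (Fin.last n) 0 σ (Fin.last n) = 0 :=
  pins_self _ _ _

theorem pinsL_castSucc {n : ℕ} (σ : Equiv.Perm (Fin n)) (i : Fin n) :
    pins (Fin.last n) 0 σ i.castSucc = (σ i).succ := by
  rw [← Fin.succAbove_last_apply, pins_above, Fin.succAbove_zero]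

theorem avoid_pinsL {n : ℕ} (σ : Equiv.Perm (Fin n)) :
    AvoidsC132 (pins (Fin.last n) 0 σ) ↔ AvoidsC132 σ := by
  unfold AvoidsC132
  apply not_congr
  constructor
  · rintro ⟨i, j, k, hij, hjk, h1, h2⟩
    induction k using Fin.lastCases with
    | last => rw [pinsL_last] at h1; exact absurd h1 (by simp)
    | cast k =>
      induction j using Fin.lastCases with
      | last => exact absurd hjk (not_lt.mpr (Fin.le_last _))
      | cast j =>
        induction i using Fin.lastCases with
        | last => exact absurd hij (not_lt.mpr (Fin.le_last _))
        | cast i =>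
          simp only [pinsL_castSucc, Fin.succ_lt_succ_iff] at h1 h2
          exact ⟨i, j, k, by simpa using hij, by simpa using hjk, h1, h2⟩
  · rintro ⟨i, j, k, hij, hjk, h1, h2⟩
    refine ⟨i.castSucc, j.castSucc, k.castSucc, by simpa using hij, by simpa using hjk, ?_, ?_⟩
    · simpa [pinsL_castSucc] using h1
    · simpa [pinsL_castSucc] using h2

theorem avoid_pins0 {n : ℕ} (v : Fin (n+2)) (σ : Equiv.Perm (Fin (n+1))) :
    AvoidsC132 (pins 0 v σ) ↔ AvoidsC132 σ ∧ (σ 0).castSucc ≤ v := by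
  constructor
  · intro h
    constructor
    · rintro ⟨i, j, k, hij, hjk, h1, h2⟩
      refine h ⟨i.succ, j.succ, k.succ, by simpa using hij, by simpa using hjk, ?_, ?_⟩
      · simpa [pins0_succ, Fin.succAbove_lt_succAbove_iff] using h1
      · simpa [pins0_succ, Fin.succAbove_lt_succAbove_iff] using h2
    · by_contra hlt
      rw [not_le] at hlt
      -- the value v occurs later in σ
      have hv : (v : ℕ) < n + 1 := lt_of_lt_of_le (Fin.lt_def.mp hlt) (by simpa using (σ 0).isLt.le)
      obtain ⟨k, hk⟩ := σ.surjective ⟨v, hv⟩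
      have hk0 : k ≠ 0 := by
        rintro rfl
        rw [hk] at hlt
        simp [Fin.lt_def] at hlt
      refine h ⟨0, (0 : Fin (n+1)).succ, k.succ, Fin.succ_pos _, ?_, ?_, ?_⟩
      · exact Fin.succ_lt_succ_iff.mpr (Fin.pos_iff_ne_zero.mpr hk0)
      · rw [pins0_zero, pins0_succ, Fin.lt_succAbove_iff_le_castSucc, hk]
        simp [Fin.le_def]
      · rw [pins0_succ, pins0_succ, Fin.succAbove_lt_succAbove_iff, hk]
        simpa [Fin.lt_def] using hlt
  · rintro ⟨ha, hv⟩ ⟨i, j, k, hij, hjk, h1, h2⟩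
    obtain ⟨k, rfl⟩ := Fin.exists_succ_eq.mpr (Fin.pos_iff_ne_zero.mp (hij.trans hjk |>.trans_le' (Fin.zero_le _)))
    obtain ⟨j, rfl⟩ := Fin.exists_succ_eq.mpr (Fin.pos_iff_ne_zero.mp (hij.trans_le' (Fin.zero_le _)))
    rw [pins0_succ, pins0_succ, Fin.succAbove_lt_succAbove_iff] at h2
    rw [Fin.succ_lt_succ_iff] at hjk
    induction i using Fin.cases with
    | zero =>
      rw [pins0_zero, pins0_succ, Fin.lt_succAbove_iff_le_castSucc] at h1
      have h3 : σ 0 ≤ σ k := by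
        have := hv.trans h1
        simpa using this
      have hk0 : k ≠ 0 := by
        rintro rfl; exact absurd hjk (by simp)
      have h4 : σ 0 < σ k := lt_of_le_of_ne h3 (fun h => hk0 (σ.injective h).symm)
      have hj0 : j ≠ 0 := by
        rintro rfl; exact absurd (h4.trans h2) (lt_irrefl _)
      exact ha ⟨0, j, k, Fin.pos_iff_ne_zero.mpr hj0, hjk, h4, h2⟩
    | succ i =>
      rw [pins0_succ, pins0_succ, Fin.succAbove_lt_succAbove_iff] at h1
      exact ha ⟨i, j, k, by simpa using hij, hjk, h1, h2⟩

noncomputable def DD (n v : ℕ) : ℕ :=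
  Nat.card {π : Equiv.Perm (Fin (n+1)) // AvoidsC132 π ∧ (π 0 : ℕ) ≤ v}

theorem BB_eq (n v : ℕ) (hv : v < n + 2) :
    Nat.card {π : Equiv.Perm (Fin (n+2)) // AvoidsC132 π ∧ (π 0 : ℕ) = v} = DD n v := by
  symm
  refine Nat.card_eq_of_bijective (fun σ => ⟨pins 0 ⟨v, hv⟩ σ.1, ?_, ?_⟩) ⟨?_, ?_⟩
  · exact (avoid_pins0 _ _).mpr ⟨σ.2.1, by simpa [Fin.le_def] using σ.2.2⟩
  · rw [pins0_zero]
  · intro a b h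
    exact Subtype.ext (pins_inj _ _ _ _ _ (congrArg Subtype.val h))
  · rintro ⟨π, h1, h2⟩
    obtain ⟨σ, hσ⟩ := pins_surj 0 π
    have hp : π 0 = ⟨v, hv⟩ := Fin.ext h2
    rw [hp] at hσ
    rw [hσ, avoid_pins0] at h1
    exact ⟨⟨σ, h1.1, by simpa [Fin.le_def] using h1.2⟩, Subtype.ext hσ.symm⟩

theorem DD_zero (n : ℕ) : DD (n+1) 0 = DD n 0 := by
  rw [← BB_eq n 0 (by omega)]
  simp only [DD, Nat.le_zero]

theorem DD_succ (n v : ℕ) (hv : v + 1 < n + 2) : DD (n+1) (v+1) = DD (n+1) v + DD n (v+1) := by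
  rw [← BB_eq n (v+1) hv]
  unfold DD
  classical
  rw [← Nat.card_sum]
  have e := subtypeOrEquiv (fun π : Equiv.Perm (Fin (n+2)) => AvoidsC132 π ∧ (π 0 : ℕ) ≤ v)
    (fun π => AvoidsC132 π ∧ (π 0 : ℕ) = v + 1) (by
      rw [Pi.disjoint_iff]
      intro π
      rw [Prop.disjoint_iff]
      grind)
  rw [← Nat.card_congr e]
  apply Nat.card_congr
  apply Equiv.subtypeEquivRight
  intro π
  grind

theorem DD_base (v : ℕ) : DD 0 v = 1 := by
  unfold DD
  rw [Nat.card_eq_one_iff_unique]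
  constructor
  · have : Subsingleton (Equiv.Perm (Fin (0+1))) := inferInstanceAs (Subsingleton (Equiv.Perm (Fin 1)))
    infer_instance
  · refine ⟨⟨1, ?_, by simp⟩⟩
    rintro ⟨i, j, k, hij, -⟩
    have := Fin.lt_def.mp hij
    omega

theorem DD_top (n v : ℕ) (hv : n ≤ v) : DD n v = DD n n := by
  unfold DD
  apply Nat.card_congr
  apply Equiv.subtypeEquivRight
  intro π
  have := (π 0).isLt
  grind

theorem DD_z (n : ℕ) : DD n 0 = 1 := by
  induction n with
  | zero => exact DD_base 0
  | succ n ih => rw [DD_zero, ih]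

theorem DD_formula (n : ℕ) : ∀ v, v ≤ n →
    DD n (v+1) + (n+v+2).choose v = (n+v+2).choose (v+1) := by
  induction n with
  | zero =>
    intro v hv
    obtain rfl : v = 0 := by omega
    simp [DD_base]
  | succ n ih =>
    have key : ∀ v, v ≤ n →
        DD (n+1) (v+1) + (n+1+v+2).choose v = (n+1+v+2).choose (v+1) := by
      intro v
      induction v with
      | zero =>
        intro _
        have := ih 0 (by omega)
        rw [DD_succ n 0 (by omega), DD_z]
        simp at this ⊢
        omega
      | succ v ihv =>
        intro hv
        have h1 := ihv (by omega)
        have h2 := ih (v+1) hv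
        rw [DD_succ n (v+1) (by omega)]
        have e1 : n + 1 + v + 2 = n + v + 3 := by omega
        have e2 : n + (v + 1) + 2 = n + v + 3 := by omega
        have e3 : n + 1 + (v + 1) + 2 = n + v + 3 + 1 := by omega
        rw [e1] at h1
        rw [e2] at h2
        rw [e3, Nat.choose_succ_succ', Nat.choose_succ_succ' _ (v+1)]
        omega
    intro v hv
    rcases Nat.lt_or_ge n v with h | h
    · obtain rfl : v = n + 1 := by omega
      have h1 := key n le_rfl
      rw [DD_top (n+1) _ (by omega)]
      have e1 : n + 1 + n + 2 = 2 * n + 3 := by omega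
      have e3 : n + 1 + (n + 1) + 2 = 2 * n + 3 + 1 := by omega
      rw [e1] at h1
      rw [e3, Nat.choose_succ_succ', Nat.choose_succ_succ' _ (n+1)]
      have : (2*n+3).choose (n+1) = (2*n+3).choose (n+2) :=
        Nat.choose_symm_of_eq_add (by omega)
      rw [show n + 1 + 1 = n + 2 from rfl]
      omega
    · exact key v h

theorem DD_catalan (n : ℕ) : DD n n = catalan (n+1) := by
  have h := DD_formula n n le_rfl
  rw [DD_top n _ (by omega)] at h
  have h2 := succ_mul_catalan_eq_centralBinom (n+1)
  rw [Nat.centralBinom_eq_two_mul_choose] at h2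
  have e : 2 * (n+1) = n + n + 2 := by omega
  rw [e] at h2
  have h3 := Nat.choose_succ_right_eq (n+n+2) n
  rw [show n + n + 2 - n = n + 2 by omega] at h3
  have : (n+2) * DD n n = (n+2) * catalan (n+1) := by
    have h2' : (n + 2) * catalan (n+1) = (n+n+2).choose (n+1) := h2
    rw [h2']
    nlinarith
  exact Nat.eq_of_mul_eq_mul_left (by omega) this

noncomputable def GG (k l n : ℕ) : ℕ :=
  Nat.card {π : Equiv.Perm (Fin n) // AvoidsC132 π ∧ BeginsInc π k ∧ EndsDec π l}

theorem endsDec_one {n : ℕ} (π : Equiv.Perm (Fin (n+1))) : EndsDec π 1 := by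
  refine ⟨by omega, fun i j hij hi => ?_⟩
  have := j.isLt
  have := Fin.lt_def.mp hij
  omega

theorem beginsInc_one {n : ℕ} (π : Equiv.Perm (Fin (n+1))) : BeginsInc π 1 := by
  refine ⟨by omega, fun i j hij hi => ?_⟩
  have := Fin.lt_def.mp hij
  omega

theorem GG_one (n : ℕ) : GG 1 1 (n+1) = catalan (n+1) := by
  rw [← DD_catalan]
  unfold GG DD
  apply Nat.card_congr
  apply Equiv.subtypeEquivRight
  intro π
  have h := (π 0).isLt
  have h1 := endsDec_one π
  have h2 := beginsInc_one π
  grind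

theorem GG_k (k n : ℕ) : GG (k+2) 1 (n+2) = GG (k+1) 1 (n+1) := by
  symm
  refine Nat.card_eq_of_bijective
    (fun σ => ⟨pins 0 (σ.1 0).castSucc σ.1, ?_, ?_, endsDec_one _⟩) ⟨?_, ?_⟩
  · exact (avoid_pins0 _ _).mpr ⟨σ.2.1, le_rfl⟩
  · obtain ⟨σ, h1, ⟨h2, h3⟩, -⟩ := σ
    refine ⟨by omega, fun i j hij hj => ?_⟩
    obtain ⟨j, rfl⟩ := Fin.exists_succ_eq.mpr (Fin.pos_iff_ne_zero.mp (hij.trans_le' (Fin.zero_le _)))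
    have hj' : (j : ℕ) < k + 1 := by simpa using hj
    induction i using Fin.cases with
    | zero =>
      rw [pins0_zero, pins0_succ, Fin.lt_succAbove_iff_le_castSucc]
      rw [Fin.castSucc_le_castSucc_iff]
      rcases eq_or_ne j 0 with rfl | h
      · exact le_rfl
      · exact (h3 0 j (Fin.pos_iff_ne_zero.mpr h) hj').le
    | succ i =>
      rw [pins0_succ, pins0_succ, Fin.succAbove_lt_succAbove_iff]
      exact h3 i j (by simpa using hij) hj'
  · intro a b h
    exact Subtype.ext (pins_inj _ _ _ _ _ (congrArg Subtype.val h))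
  · rintro ⟨π, h1, ⟨h2, h3⟩, -⟩
    obtain ⟨σ, hσ⟩ := pins_surj 0 π
    generalize π 0 = v at hσ
    subst hσ
    rw [avoid_pins0] at h1
    have hv : v = (σ 0).castSucc := by
      apply le_antisymm _ h1.2
      have := h3 0 (Fin.succ 0) (Fin.succ_pos _) (by simp)
      rwa [pins0_zero, pins0_succ, Fin.lt_succAbove_iff_le_castSucc] at this
    refine ⟨⟨σ, h1.1, ⟨by omega, fun i j hij hj => ?_⟩, endsDec_one _⟩, Subtype.ext (congrArg (fun w => pins 0 w σ) hv.symm)⟩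
    have := h3 i.succ j.succ (by simpa using hij) (by simpa using hj)
    rwa [pins0_succ, pins0_succ, Fin.succAbove_lt_succAbove_iff] at this

theorem GG_l (k l n : ℕ) (hk : k ≤ n) (hn : l + 1 ≤ n) : GG k (l+2) (n+1) = GG k (l+1) n := by
  symm
  refine Nat.card_eq_of_bijective
    (fun σ => ⟨pins (Fin.last n) 0 σ.1, ?_, ?_, ?_⟩) ⟨?_, ?_⟩
  · exact (avoid_pinsL _).mpr σ.2.1
  · obtain ⟨σ, h1, ⟨h2, h3⟩, -⟩ := σ
    refine ⟨by omega, fun i j hij hj => ?_⟩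
    induction j using Fin.lastCases with
    | last => simp at hj; omega
    | cast j =>
      induction i using Fin.lastCases with
      | last => exact absurd hij (not_lt.mpr (Fin.le_last _))
      | cast i =>
        rw [pinsL_castSucc, pinsL_castSucc, Fin.succ_lt_succ_iff]
        exact h3 i j (by simpa using hij) (by simpa using hj)
  · obtain ⟨σ, h1, -, ⟨h2, h3⟩⟩ := σ
    refine ⟨by omega, fun i j hij hi => ?_⟩
    induction i using Fin.lastCases with
    | last => exact absurd hij (not_lt.mpr (Fin.le_last _))
    | cast i =>
      induction j using Fin.lastCases with
      | last => rw [pinsL_castSucc, pinsL_last]; exact Fin.succ_pos _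
      | cast j =>
        rw [pinsL_castSucc, pinsL_castSucc, Fin.succ_lt_succ_iff]
        exact h3 i j (by simpa using hij) (by simp at hi; omega)
  · intro a b h
    exact Subtype.ext (pins_inj _ _ _ _ _ (congrArg Subtype.val h))
  · rintro ⟨π, h1, ⟨h2, h3⟩, ⟨h4, h5⟩⟩
    have h0 : π (Fin.last n) = 0 := by
      by_contra hne
      obtain ⟨i, hi⟩ := π.surjective 0
      have hn1 : n - 1 < n + 1 := by omega
      have hlt := h5 ⟨n-1, hn1⟩ (Fin.last n) (by simp [Fin.lt_def]; omega) (by simp; omega)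
      have hil : i ≠ Fin.last n := by rintro rfl; exact hne hi
      have hil' : (i : ℕ) ≠ n := fun h => hil (Fin.ext h)
      have hin : i ≠ ⟨n-1, hn1⟩ := by
        rintro rfl; rw [hi] at hlt; exact absurd hlt (by simp)
      have hin' : (i : ℕ) ≠ n - 1 := fun h => hin (Fin.ext h)
      refine h1 ⟨i, ⟨n-1, hn1⟩, Fin.last n, ?_, ?_, ?_, hlt⟩
      · have := i.isLt
        simp only [Fin.lt_def]; omega
      · simp only [Fin.lt_def, Fin.val_last]; omega
      · rw [hi]; exact Fin.pos_iff_ne_zero.mpr hne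
    obtain ⟨σ, hσ⟩ := pins_surj (Fin.last n) π
    rw [h0] at hσ
    clear h0
    subst hσ
    rw [avoid_pinsL] at h1
    refine ⟨⟨σ, h1, ⟨hk, fun i j hij hj => ?_⟩, ⟨hn, fun i j hij hi => ?_⟩⟩, rfl⟩
    · have := h3 i.castSucc j.castSucc (by simpa using hij) (by simpa using hj)
      rwa [pinsL_castSucc, pinsL_castSucc, Fin.succ_lt_succ_iff] at this
    · have := h5 i.castSucc j.castSucc (by simpa using hij) (by simp; omega)
      rwa [pinsL_castSucc, pinsL_castSucc, Fin.succ_lt_succ_iff] at this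

theorem GG_k_all (k m : ℕ) : GG (k+1) 1 (m+k+1) = catalan (m+1) := by
  induction k with
  | zero => exact GG_one m
  | succ k ih => rw [← ih]; exact GG_k k (m+k)

theorem GG_all (k l m : ℕ) : GG (k+1) (l+1) (m+k+l+1) = catalan (m+1) := by
  induction l with
  | zero => exact GG_k_all k m
  | succ l ih => rw [← ih]; exact GG_l (k+1) l (m+k+l+1) (by omega) (by omega)

theorem avoidC132_beginInc_endDec_count (k l n : ℕ) (hk : 1 ≤ k) (hl : 1 ≤ l) :
    (k + l - 1 ≤ n →
      Nat.card {π : Equiv.Perm (Fin n) // AvoidsC132 π ∧ BeginsInc π k ∧ EndsDec π l}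
        = catalan (n + 2 - k - l)) ∧
    (n < k + l - 1 →
      Nat.card {π : Equiv.Perm (Fin n) // AvoidsC132 π ∧ BeginsInc π k ∧ EndsDec π l}
        = 0) := by
  obtain ⟨k, rfl⟩ := Nat.exists_eq_add_of_le' hk
  obtain ⟨l, rfl⟩ := Nat.exists_eq_add_of_le' hl
  constructor
  · intro h
    obtain ⟨m, rfl⟩ : ∃ m, n = m + k + l + 1 := ⟨n - k - l - 1, by omega⟩
    rw [show m + k + l + 1 + 2 - (k + 1) - (l + 1) = m + 1 by omega]
    exact GG_all k l m
  · intro h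
    rw [Nat.card_eq_zero]
    left
    constructor
    rintro ⟨π, -, ⟨h2, h3⟩, ⟨h4, h5⟩⟩
    have a := h3 ⟨k-1, by omega⟩ ⟨k, by omega⟩ (by simp only [Fin.lt_def]; omega) (by simp)
    have b := h5 ⟨k-1, by omega⟩ ⟨k, by omega⟩ (by simp only [Fin.lt_def]; omega)
      (by simp only []; omega)
    exact absurd (a.trans b) (lt_irrefl _)
end

section
/- For n ≥ 2 and 1 ≤ a,b ≤ n with a ≠ b, let g_n(a;b) denote the number of permutations of length n that avoid the classical pattern 1-2-3 and satisfy π_1 = a and π_n = b. Then: (a) g_n(a;b) = 0 whenever b ≥ a+2; and (b) g_n(a;a+1) = binom(n-2, a-1) for all 1 ≤ a ≤ n-1. -/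
/-- `g n a b` is the number of permutations of length `n` avoiding the classical
pattern 1-2-3 whose first letter is `a` and last letter is `b`
(letters being `1, …, n`). -/
noncomputable def g (n a b : ℕ) : ℕ :=
  Nat.card {π : Equiv.Perm (Fin n) //
    AvoidsC123 π ∧ ∃ h : 0 < n,
      ((π ⟨0, h⟩ : Fin n) : ℕ) + 1 = a ∧ ((π ⟨n - 1, by omega⟩ : Fin n) : ℕ) + 1 = b}

open Finset in
lemma perm_val_card {n : ℕ} (π : Equiv.Perm (Fin n)) (i : Fin n) :
    (π i : ℕ) = (univ.filter (fun j => π j < π i)).card := by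
  have h : (univ.filter (fun j => π j < π i)).map π.toEmbedding = Finset.Iio (π i) := by
    ext x
    simp only [mem_map, mem_filter, mem_univ, true_and, mem_Iio, Equiv.coe_toEmbedding]
    constructor
    · rintro ⟨a, ha, rfl⟩; exact ha
    · intro hx; exact ⟨π.symm x, by simpa using hx, by simp⟩
  rw [← card_map π.toEmbedding, h, Fin.card_Iio]

/-- sorting key -/
def keyF (m : ℕ) (S : Finset (Fin (m+2))) (i : Fin (m+2)) : ℕ :=
  if i ∈ S then m + 2 - i.val else if i.val = 0 then m + 2 else
    if i.val = m + 1 then m + 3 else 3 * (m + 2) - i.val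

def GoodP (m A : ℕ) (π : Equiv.Perm (Fin (m+2))) : Prop :=
  AvoidsC123 π ∧ (π 0 : ℕ) = A ∧ (π (Fin.last (m+1)) : ℕ) = A + 1

def lowS (m A : ℕ) (π : Equiv.Perm (Fin (m+2))) : Finset (Fin (m+2)) :=
  Finset.univ.filter (fun i => (π i : ℕ) < A)

lemma keyF_inj (m : ℕ) (S : Finset (Fin (m+2))) (h0 : 0 ∉ S) (hl : Fin.last (m+1) ∉ S) :
    Function.Injective (keyF m S) := by
  intro i j h
  have hi : i ∈ S → i.val ≠ 0 := fun h h' => h0 (by rwa [show i = 0 from Fin.ext h'] at h)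
  have hj : j ∈ S → j.val ≠ 0 := fun h h' => h0 (by rwa [show j = 0 from Fin.ext h'] at h)
  have := i.isLt
  have := j.isLt
  unfold keyF at h
  apply Fin.ext
  split_ifs at h <;> first | omega | (have := hi ‹_›; omega) | (have := hj ‹_›; omega)

lemma good_mono {m A : ℕ} {π : Equiv.Perm (Fin (m+2))} (h : GoodP m A π) (i j : Fin (m+2))
    (hij : π i < π j) : keyF m (lowS m A π) i < keyF m (lowS m A π) j := by
  obtain ⟨hav, h0, hl⟩ := h
  have hij' : (π i : ℕ) < π j := hij
  have hne : i.val ≠ j.val := fun h => by rw [Fin.ext h] at hij; exact lt_irrefl _ hij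
  have e0 : ∀ i : Fin (m+2), (π i : ℕ) = A → i.val = 0 := fun i h => by
    have : π i = π 0 := Fin.ext (by omega)
    rw [π.injective this]; rfl
  have el : ∀ i : Fin (m+2), (π i : ℕ) = A + 1 → i.val = m + 1 := fun i h => by
    have : π i = π (Fin.last (m+1)) := Fin.ext (by omega)
    rw [π.injective this]; rfl
  have f0 : ∀ i : Fin (m+2), i.val = 0 → (π i : ℕ) = A := fun i h => by
    rw [show i = 0 from Fin.ext h]; exact h0
  have fl : ∀ i : Fin (m+2), i.val = m + 1 → (π i : ℕ) = A + 1 := fun i h => by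
    rw [show i = Fin.last (m+1) from Fin.ext h]; exact hl
  -- lows decreasing
  have dl : (π j : ℕ) < A → j.val < i.val := fun hj => by
    by_contra hc
    have : j.val ≠ m + 1 := fun h => by have := fl j h; omega
    exact hav ⟨i, j, Fin.last (m+1), Fin.lt_def.2 (by omega),
      Fin.lt_def.2 (by have := j.isLt; simp only [Fin.val_last]; omega), hij, Fin.lt_def.2 (by omega)⟩
  have dh : A + 1 < (π i : ℕ) → j.val < i.val := fun hj => by
    by_contra hc
    have : i.val ≠ 0 := fun h => by have := f0 i h; omega
    exact hav ⟨0, i, j, Fin.lt_def.2 (by simp only [Fin.val_zero]; omega),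
      Fin.lt_def.2 (by omega), Fin.lt_def.2 (by omega), hij⟩
  have a1 := e0 i
  have a2 := e0 j
  have a3 := el i
  have a4 := el j
  have a5 := f0 i
  have a6 := f0 j
  have a7 := fl i
  have a8 := fl j
  have := i.isLt
  have := j.isLt
  simp only [keyF, lowS, Finset.mem_filter, Finset.mem_univ, true_and]
  split_ifs <;> omega

lemma lt_iff_of {n : ℕ} {π : Equiv.Perm (Fin n)} {k : Fin n → ℕ}
    (h : ∀ i j, π i < π j → k i < k j) (i j : Fin n) : π i < π j ↔ k i < k j := by
  refine ⟨h i j, fun hk => ?_⟩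
  rcases lt_trichotomy (π i) (π j) with h1 | h1 | h1
  · exact h1
  · rw [π.injective h1] at hk; omega
  · have := h _ _ h1; omega

lemma lowS_mem {m A : ℕ} {π : Equiv.Perm (Fin (m+2))} (h : GoodP m A π) :
    lowS m A π ∈ Finset.powersetCard A (Finset.univ \ {0, Fin.last (m+1)}) := by
  obtain ⟨hav, h0, hl⟩ := h
  rw [Finset.mem_powersetCard]
  constructor
  · intro i hi
    simp only [lowS, Finset.mem_filter, Finset.mem_univ, true_and] at hi
    simp only [Finset.mem_sdiff, Finset.mem_univ, true_and, Finset.mem_insert,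
      Finset.mem_singleton, not_or]
    constructor <;> rintro rfl <;> omega
  · have := perm_val_card π 0
    rw [h0] at this
    conv_rhs => rw [this]
    congr 1
    ext i
    simp [lowS, Fin.lt_def, h0]

open Finset in
lemma exists_rank {n : ℕ} (k : Fin n → ℕ) (hk : Function.Injective k) :
    ∃ π : Equiv.Perm (Fin n), ∀ i j, π i < π j ↔ k i < k j := by
  have hlt : ∀ i, (univ.filter (fun j => k j < k i)).card < n := fun i => by
    have : (univ.filter (fun j => k j < k i)) ⊂ univ := by
      rw [Finset.ssubset_univ_iff]
      intro h
      have : i ∈ (univ.filter (fun j => k j < k i)) := by rw [h]; simp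
      simp at this
    simpa using Finset.card_lt_card this
  let f : Fin n → Fin n := fun i => ⟨_, hlt i⟩
  have hm : ∀ i j, k i < k j → f i < f j := fun i j h => by
    apply Fin.lt_def.2
    show (univ.filter (fun x => k x < k i)).card < (univ.filter (fun x => k x < k j)).card
    apply Finset.card_lt_card
    rw [Finset.ssubset_iff_of_subset]
    · exact ⟨i, by simpa using h, by simp⟩
    · intro x hx
      simp only [mem_filter, mem_univ, true_and] at hx ⊢
      omega
  have hinj : Function.Injective f := fun i j h => by
    apply hk
    rcases lt_trichotomy (k i) (k j) with h1 | h1 | h1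
    · have := hm _ _ h1; rw [h] at this; exact absurd this (lt_irrefl _)
    · exact h1
    · have := hm _ _ h1; rw [h] at this; exact absurd this (lt_irrefl _)
  refine ⟨Equiv.ofBijective f (Finite.injective_iff_bijective.1 hinj), fun i j => ?_⟩
  refine ⟨fun h => ?_, fun h => hm i j h⟩
  by_contra hc
  rcases lt_or_eq_of_le (not_lt.1 hc) with h1 | h1
  · exact absurd (hm _ _ h1) (lt_asymm h)
  · rw [hk h1] at h; exact absurd h (lt_irrefl _)

lemma surj_aux {m A : ℕ} (S : Finset (Fin (m+2)))
    (hS : S ∈ Finset.powersetCard A (Finset.univ \ {0, Fin.last (m+1)})) :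
    ∃ π, GoodP m A π ∧ lowS m A π = S := by
  rw [Finset.mem_powersetCard] at hS
  obtain ⟨hsub, hc⟩ := hS
  have h0 : (0 : Fin (m+2)) ∉ S := fun h => by simpa using hsub h
  have hl : Fin.last (m+1) ∉ S := fun h => by simpa using hsub h
  have n0 : ∀ i : Fin (m+2), i ∈ S → i.val ≠ 0 :=
    fun i h h' => h0 (by rwa [show i = 0 from Fin.ext h'] at h)
  have nl : ∀ i : Fin (m+2), i ∈ S → i.val ≠ m + 1 :=
    fun i h h' => hl (by rwa [show i = Fin.last (m+1) from Fin.ext h'] at h)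
  obtain ⟨π, hπ⟩ := exists_rank _ (keyF_inj m S h0 hl)
  have k0 : keyF m S 0 = m + 2 := by simp [keyF, h0]
  have kl : keyF m S (Fin.last (m+1)) = m + 3 := by simp [keyF, hl]
  have lt0 : ∀ i, keyF m S i < m + 2 ↔ i ∈ S := fun i => by
    have := n0 i
    have := i.isLt
    unfold keyF
    split_ifs with h <;> simp only [h, iff_true, iff_false] <;> first | omega | (have := n0 i h; omega)
  have ltl : ∀ i, keyF m S i < m + 3 ↔ i ∈ insert 0 S := fun i => by
    have := i.isLt
    have e0 : ((0 : Fin (m+2)) : ℕ) = 0 := rfl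
    have := n0 i
    rw [Finset.mem_insert, Fin.ext_iff, e0]
    unfold keyF
    split_ifs with h h' <;> simp only [h, or_true, or_false, iff_true] <;> omega
  have p0 : (π 0 : ℕ) = A := by
    rw [perm_val_card, ← hc]
    congr 1; ext i
    simp [hπ, k0, lt0]
  have pl : (π (Fin.last (m+1)) : ℕ) = A + 1 := by
    rw [perm_val_card, ← hc, ← Finset.card_insert_of_notMem h0]
    congr 1; ext i
    simp only [hπ, kl, ltl, Finset.mem_filter, Finset.mem_univ, true_and]
  refine ⟨π, ⟨?_, p0, pl⟩, ?_⟩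
  · rintro ⟨i, j, k, hij, hjk, h1, h2⟩
    rw [hπ] at h1 h2
    rw [Fin.lt_def] at hij hjk
    have := k.isLt
    have := n0 i
    have := n0 j
    have := n0 k
    unfold keyF at h1 h2
    split_ifs at h1 h2 <;> omega
  · ext i
    have := hπ i 0
    rw [k0, lt0, Fin.lt_def, p0] at this
    rw [← this]
    simp [lowS]

lemma card_good (m A : ℕ) : Nat.card {π // GoodP m A π} = Nat.choose m A := by
  have hb : Function.Bijective (fun π : {π // GoodP m A π} =>
      (⟨lowS m A π.1, lowS_mem π.2⟩ :
        {S // S ∈ Finset.powersetCard A (Finset.univ \ {0, Fin.last (m+1)})})) := by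
    constructor
    · rintro ⟨π, h⟩ ⟨σ, h'⟩ he
      have he : lowS m A π = lowS m A σ := congrArg Subtype.val he
      apply Subtype.ext
      ext i
      show (π i : ℕ) = σ i
      rw [perm_val_card, perm_val_card]
      congr 1; ext j
      simp only [Finset.mem_filter, Finset.mem_univ, true_and]
      rw [lt_iff_of (good_mono h), lt_iff_of (good_mono h'), he]
    · rintro ⟨S, hS⟩
      obtain ⟨π, h, h'⟩ := surj_aux S hS
      exact ⟨⟨π, h⟩, Subtype.ext h'⟩
  rw [Nat.card_eq_of_bijective _ hb, Nat.card_eq_fintype_card, Fintype.card_coe,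
    Finset.card_powersetCard, Finset.card_sdiff_of_subset (Finset.subset_univ _),
    Finset.card_univ, Fintype.card_fin, Finset.card_pair]
  · rfl
  · exact (Fin.last_pos).ne

theorem avoidC123_first_last_count (n : ℕ) (hn : 2 ≤ n) :
    (∀ a b : ℕ, 1 ≤ a → a ≤ n → 1 ≤ b → b ≤ n → a + 2 ≤ b → g n a b = 0) ∧
    (∀ a : ℕ, 1 ≤ a → a ≤ n - 1 → g n a (a + 1) = Nat.choose (n - 2) (a - 1)) := by
  constructor
  · intro a b ha han hb hbn hab
    unfold g
    rw [Nat.card_eq_zero]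
    left
    constructor
    rintro ⟨π, hav, h, h1, h2⟩
    obtain ⟨j, hj⟩ := π.surjective ⟨a, by omega⟩
    have hj' : (π j : ℕ) = a := by rw [hj]
    have j0 : j.val ≠ 0 := fun hh => by
      rw [show j = ⟨0, h⟩ from Fin.ext hh] at hj'; omega
    have jl : j.val ≠ n - 1 := fun hh => by
      rw [show j = ⟨n - 1, by omega⟩ from Fin.ext hh] at hj'; omega
    have := j.isLt
    exact hav ⟨⟨0, h⟩, j, ⟨n - 1, by omega⟩, Fin.lt_def.2 (by simp only; omega),
      Fin.lt_def.2 (by simp only; omega), Fin.lt_def.2 (by omega), Fin.lt_def.2 (by omega)⟩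
  · intro a ha han
    obtain ⟨m, rfl⟩ : ∃ m, n = m + 2 := ⟨n - 2, by omega⟩
    obtain ⟨A, rfl⟩ : ∃ A, a = A + 1 := ⟨a - 1, by omega⟩
    have := card_good m A
    simp only [Nat.add_sub_cancel]
    rw [← this]
    unfold g
    apply Nat.card_congr
    apply Equiv.subtypeEquivRight
    intro π
    unfold GoodP
    refine and_congr Iff.rfl ⟨?_, ?_⟩
    · rintro ⟨h, h1, h2⟩
      exact ⟨Nat.succ_injective h1, Nat.succ_injective h2⟩
    · rintro ⟨h1, h2⟩
      exact ⟨by omega, congrArg Nat.succ h1, congrArg Nat.succ h2⟩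
end

section
/- For all k ≥ 1, ℓ ≥ 2 and n ≥ ℓ, the number of permutations of length n that avoid the generalized pattern 1-32, begin with the pattern 12⋯k, and end with the pattern ℓ(ℓ-1)⋯1, equals the number of permutations of length n-ℓ+1 that avoid 1-32 and begin with the pattern 12⋯k. -/
/-- `π` avoids the generalized pattern 1-32: there are no indices `i < j` with
`j + 1` still a position and `π i < π (j+1) < π j`. -/
def Avoids1d32 {n : ℕ} (π : Equiv.Perm (Fin n)) : Prop :=
  ¬ ∃ i j : Fin n, ∃ h : (j : ℕ) + 1 < n,
      i < j ∧ π i < π ⟨(j : ℕ) + 1, h⟩ ∧ π ⟨(j : ℕ) + 1, h⟩ < π j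

theorem aux_last_small {m d : ℕ} (π : Equiv.Perm (Fin (m + 1 + d))) (ha : Avoids1d32 π)
    (he : EndsDec π (d + 1)) (i i' : Fin (m + 1 + d)) (hi : m + 1 ≤ (i : ℕ)) (h : i' < i) :
    π i < π i' := by
  have hlt : (i' : ℕ) < i := h
  by_cases h1 : (i' : ℕ) + 1 = i
  · exact he.2 i' i h (by omega)
  · by_contra hc
    have hne : π i ≠ π i' := fun e => by
      have := π.injective e
      rw [this] at hlt
      omega
    apply ha
    have hi2 := i.2
    have e : (⟨(i : ℕ) - 1 + 1, by omega⟩ : Fin (m + 1 + d)) = i := by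
      ext; simp; omega
    refine ⟨i', ⟨(i : ℕ) - 1, by omega⟩, by simp; omega, ?_, ?_, ?_⟩
    · rw [Fin.lt_def]; simp; omega
    · simp only [e]
      exact lt_of_le_of_ne (not_lt.mp hc) hne.symm
    · simp only [e]
      exact he.2 _ _ (by rw [Fin.lt_def]; change (i : ℕ) - 1 < i; omega) (by simp; omega)

theorem aux_last_val {m d : ℕ} (π : Equiv.Perm (Fin (m + 1 + d))) (ha : Avoids1d32 π)
    (he : EndsDec π (d + 1)) (i : Fin (m + 1 + d)) (hi : m + 1 ≤ (i : ℕ)) :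
    (π i : ℕ) = m + d - i := by
  have h1 : (Finset.Ioi i).map π.toEmbedding = Finset.Iio (π i) := by
    ext v
    simp only [Finset.mem_map, Finset.mem_Ioi, Finset.mem_Iio, Equiv.coe_toEmbedding]
    constructor
    · rintro ⟨a, ha', rfl⟩
      exact he.2 i a ha' (by omega)
    · intro hv
      refine ⟨π.symm v, ?_, by simp⟩
      rcases lt_trichotomy i (π.symm v) with h | h | h
      · exact h
      · rw [h] at hv; simp at hv
      · have := aux_last_small π ha he i _ hi h
        simp at this
        exact absurd hv (not_lt.mpr this.le)
  have h2 := congrArg Finset.card h1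
  rw [Finset.card_map, Fin.card_Ioi, Fin.card_Iio] at h2
  omega

def extFun {m d : ℕ} (σ : Equiv.Perm (Fin (m + 1))) (i : Fin (m + 1 + d)) : Fin (m + 1 + d) :=
  if h : (i : ℕ) < m + 1 then ⟨(σ ⟨i, h⟩ : ℕ) + d, by have := (σ ⟨i, h⟩).2; omega⟩
  else ⟨m + d - i, by omega⟩

theorem extFun_lt {m d : ℕ} (σ : Equiv.Perm (Fin (m + 1))) (i : Fin (m + 1 + d))
    (h : (i : ℕ) < m + 1) : (extFun σ i : ℕ) = (σ ⟨i, h⟩ : ℕ) + d := by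
  simp [extFun, h]

theorem extFun_ge {m d : ℕ} (σ : Equiv.Perm (Fin (m + 1))) (i : Fin (m + 1 + d))
    (h : m + 1 ≤ (i : ℕ)) : (extFun σ i : ℕ) = m + d - i := by
  simp [extFun, not_lt.mpr h]

theorem extFun_inj {m d : ℕ} (σ : Equiv.Perm (Fin (m + 1))) :
    Function.Injective (extFun (d := d) σ) := by
  intro a b hab
  have hab' : (extFun σ a : ℕ) = extFun σ b := by rw [hab]
  have ha2 := a.2
  have hb2 := b.2
  rcases lt_or_ge (a : ℕ) (m + 1) with ha | ha <;> rcases lt_or_ge (b : ℕ) (m + 1) with hb | hb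
  · rw [extFun_lt σ a ha, extFun_lt σ b hb] at hab'
    have : σ ⟨a, ha⟩ = σ ⟨b, hb⟩ := by ext; omega
    have := σ.injective this
    simp at this
    exact Fin.ext this
  · rw [extFun_lt σ a ha, extFun_ge σ b hb] at hab'
    omega
  · rw [extFun_ge σ a ha, extFun_lt σ b hb] at hab'
    omega
  · rw [extFun_ge σ a ha, extFun_ge σ b hb] at hab'
    ext; omega

noncomputable def extPerm {m d : ℕ} (σ : Equiv.Perm (Fin (m + 1))) :
    Equiv.Perm (Fin (m + 1 + d)) :=
  Equiv.ofBijective (extFun σ) (Finite.injective_iff_bijective.mp (extFun_inj σ))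

theorem extPerm_lt {m d : ℕ} (σ : Equiv.Perm (Fin (m + 1))) (i : Fin (m + 1 + d))
    (h : (i : ℕ) < m + 1) : (extPerm σ i : ℕ) = (σ ⟨i, h⟩ : ℕ) + d := extFun_lt σ i h

theorem extPerm_ge {m d : ℕ} (σ : Equiv.Perm (Fin (m + 1))) (i : Fin (m + 1 + d))
    (h : m + 1 ≤ (i : ℕ)) : (extPerm σ i : ℕ) = m + d - i := extFun_ge σ i h

theorem ext_endsDec {m d : ℕ} (σ : Equiv.Perm (Fin (m + 1))) :
    EndsDec (extPerm (d := d) σ) (d + 1) := by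
  refine ⟨by omega, fun i j hij hi => ?_⟩
  rw [Fin.lt_def] at hij ⊢
  have := j.2
  rw [extPerm_ge σ j (by omega)]
  rcases lt_or_ge (i : ℕ) (m + 1) with h | h
  · rw [extPerm_lt σ i h]; omega
  · rw [extPerm_ge σ i h]; omega

theorem ext_avoids {m d : ℕ} (σ : Equiv.Perm (Fin (m + 1))) :
    Avoids1d32 (extPerm (d := d) σ) ↔ Avoids1d32 σ := by
  unfold Avoids1d32
  rw [not_iff_not]
  constructor
  · rintro ⟨i, j, h, h1, h2, h3⟩
    rw [Fin.lt_def] at h1 h2 h3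
    rcases lt_or_ge ((j : ℕ) + 1) (m + 1) with hj | hj
    · rw [extPerm_lt σ ⟨j + 1, h⟩ hj, extPerm_lt σ i (by omega)] at h2
      rw [extPerm_lt σ ⟨j + 1, h⟩ hj, extPerm_lt σ j (by omega)] at h3
      refine ⟨⟨i, by omega⟩, ⟨j, by omega⟩, hj, h1, ?_, ?_⟩
      · rw [Fin.lt_def]; simp only at h2 ⊢; omega
      · rw [Fin.lt_def]; simp only at h3 ⊢; omega
    · exfalso
      rw [extPerm_ge σ ⟨j + 1, h⟩ hj] at h2
      simp only at h2
      rcases lt_or_ge (i : ℕ) (m + 1) with hi | hi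
      · rw [extPerm_lt σ i hi] at h2; omega
      · rw [extPerm_ge σ i hi] at h2; omega
  · rintro ⟨i, j, h, h1, h2, h3⟩
    rw [Fin.lt_def] at h1 h2 h3
    refine ⟨⟨i, by omega⟩, ⟨j, by omega⟩, by simp only; omega, h1, ?_, ?_⟩
    · rw [Fin.lt_def, extPerm_lt σ ⟨i, _⟩ (by simp only; omega), extPerm_lt σ ⟨j + 1, _⟩ h]
      simp only [Fin.eta] at h2 ⊢; omega
    · rw [Fin.lt_def, extPerm_lt σ ⟨j, _⟩ (by simp only; omega), extPerm_lt σ ⟨j + 1, _⟩ h]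
      simp only [Fin.eta] at h3 ⊢; omega

theorem ext_begins {m d k : ℕ} (hd : 1 ≤ d) (σ : Equiv.Perm (Fin (m + 1))) :
    BeginsInc (extPerm (d := d) σ) k ↔ BeginsInc σ k := by
  constructor
  · rintro ⟨h, h'⟩
    have hk : k ≤ m + 1 := by
      by_contra hc
      have := h' ⟨m, by omega⟩ ⟨m + 1, by omega⟩ (by simp) (by simp only; omega)
      rw [Fin.lt_def, extPerm_lt σ ⟨m, _⟩ (by simp), extPerm_ge σ ⟨m + 1, _⟩ (by simp)] at this
      simp only at this
      omega
    refine ⟨hk, fun i j hij hj => ?_⟩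
    have := h' ⟨i, by omega⟩ ⟨j, by omega⟩ hij hj
    rw [Fin.lt_def, extPerm_lt σ ⟨i, _⟩ i.2, extPerm_lt σ ⟨j, _⟩ j.2] at this
    rw [Fin.lt_def]; simp only [Fin.eta] at this; omega
  · rintro ⟨h, h'⟩
    refine ⟨by omega, fun i j hij hj => ?_⟩
    rw [Fin.lt_def] at hij
    rw [Fin.lt_def, extPerm_lt σ i (by omega), extPerm_lt σ j (by omega)]
    have := h' ⟨i, by omega⟩ ⟨j, by omega⟩ hij hj
    rw [Fin.lt_def] at this
    omega

theorem ext_surj {m d : ℕ} (hd : 1 ≤ d) (π : Equiv.Perm (Fin (m + 1 + d))) (ha : Avoids1d32 π)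
    (he : EndsDec π (d + 1)) : ∃ σ : Equiv.Perm (Fin (m + 1)), extPerm σ = π := by
  have hge : ∀ i : Fin (m + 1 + d), (i : ℕ) < m + 1 → d ≤ (π i : ℕ) := by
    intro i hi
    have h1 := aux_last_small π ha he ⟨m + 1, by omega⟩ i (by simp) (by rw [Fin.lt_def]; exact hi)
    have h2 := aux_last_val π ha he ⟨m + 1, by omega⟩ (by simp)
    rw [Fin.lt_def, h2] at h1
    simp only at h1
    omega
  let f : Fin (m + 1) → Fin (m + 1) := fun i =>
    ⟨(π ⟨i, by omega⟩ : ℕ) - d, by have := (π ⟨i, by omega⟩).2; omega⟩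
  have hf : Function.Injective f := by
    intro a b hab
    have h1 := hge ⟨a, by omega⟩ a.2
    have h2 := hge ⟨b, by omega⟩ b.2
    have h3 : (π ⟨a, by omega⟩ : ℕ) - d = (π ⟨b, by omega⟩ : ℕ) - d := congrArg Fin.val hab
    have h4 : π ⟨a, by omega⟩ = π ⟨b, by omega⟩ := by ext; omega
    have := π.injective h4
    simp at this
    exact Fin.ext this
  refine ⟨Equiv.ofBijective f (Finite.injective_iff_bijective.mp hf), ?_⟩
  ext i
  rcases lt_or_ge (i : ℕ) (m + 1) with h | h
  · rw [extPerm_lt _ i h]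
    have := hge i h
    change ((π i : ℕ) - d) + d = _
    omega
  · rw [extPerm_ge _ i h, aux_last_val π ha he i h]

theorem ext_perm_inj {m d : ℕ} : Function.Injective (extPerm (m := m) (d := d)) := by
  intro σ τ h
  ext i
  have h1 : (extPerm σ ⟨i, by omega⟩ : Fin (m + 1 + d)) = extPerm τ ⟨i, by omega⟩ := by rw [h]
  have h2 := congrArg Fin.val h1
  rw [extPerm_lt σ _ i.2, extPerm_lt τ _ i.2] at h2
  simp only [Fin.eta] at h2
  omega

theorem avoid1d32_beginInc_endDec_count (k l n : ℕ) (hk : 1 ≤ k) (hl : 2 ≤ l)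
    (hln : l ≤ n) :
    Nat.card {π : Equiv.Perm (Fin n) // Avoids1d32 π ∧ BeginsInc π k ∧ EndsDec π l}
      = Nat.card {π : Equiv.Perm (Fin (n - l + 1)) // Avoids1d32 π ∧ BeginsInc π k} := by
  obtain ⟨m, rfl⟩ : ∃ m, n = m + l := ⟨n - l, by omega⟩
  obtain ⟨d, rfl⟩ : ∃ d, l = d + 1 := ⟨l - 1, by omega⟩
  have e1 : m + (d + 1) - (d + 1) + 1 = m + 1 := by omega
  have e2 : m + (d + 1) = m + 1 + d := by omega
  rw [e1, e2]
  symm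
  refine Nat.card_eq_of_bijective
    (fun σ => ⟨extPerm σ.1, (ext_avoids σ.1).mpr σ.2.1,
      (ext_begins (by omega) σ.1).mpr σ.2.2, ext_endsDec σ.1⟩) ⟨?_, ?_⟩
  · intro σ τ h
    exact Subtype.ext (ext_perm_inj (congrArg Subtype.val h))
  · rintro ⟨π, ha, hb, he⟩
    obtain ⟨σ, rfl⟩ := ext_surj (by omega) π ha he
    exact ⟨⟨σ, (ext_avoids σ).mp ha, (ext_begins (by omega) σ).mp hb⟩, rfl⟩
end

section
/- For k ≥ 1 and m ≥ 0, let M_k(m) denote the number of permutations of length m that avoid the generalized pattern 1-23 and begin with the pattern k(k-1)⋯1 (so M_k(m) = 0 for m < k). Then for all n ≥ 1, the number of permutations of length n+1 that avoid 1-23, begin with the pattern k(k-1)⋯1, and end with the pattern 12, equals n·M_k(n-1) + k·δ_{n,k}, where δ is the Kronecker delta. -/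
/-- `π` avoids the generalized pattern 1-23: there are no indices `i < j` with
`j + 1` still a position and `π i < π j < π (j+1)`. -/
def Avoids1d23 {n : ℕ} (π : Equiv.Perm (Fin n)) : Prop :=
  ¬ ∃ i j : Fin n, ∃ h : (j : ℕ) + 1 < n,
      i < j ∧ π i < π j ∧ π j < π ⟨(j : ℕ) + 1, h⟩

/-- `π` ends with the pattern `12`: it has length at least 2 and
`π (n-1) < π n`. -/
def EndsInc12 {n : ℕ} (π : Equiv.Perm (Fin n)) : Prop :=
  ∃ h : 1 < n, π ⟨n - 2, by omega⟩ < π ⟨n - 1, by omega⟩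

/-- `M k m` is the number of permutations of length `m` avoiding the generalized
pattern 1-23 and beginning with the pattern `k(k-1)⋯1`. -/
noncomputable def M (k m : ℕ) : ℕ :=
  Nat.card {π : Equiv.Perm (Fin m) // Avoids1d23 π ∧ BeginsDec π k}

def gAux {m : ℕ} (v : Fin (m + 1)) (x : Fin m) : Fin (m + 2) := (v.succAbove x).succ

theorem gAux_lt {m : ℕ} (v : Fin (m + 1)) (a b : Fin m) : gAux v a < gAux v b ↔ a < b := by
  unfold gAux
  rw [Fin.succ_lt_succ_iff]
  exact (Fin.strictMono_succAbove v).lt_iff_lt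

theorem gAux_inj {m : ℕ} (v : Fin (m + 1)) (a b : Fin m) : gAux v a = gAux v b ↔ a = b := by
  unfold gAux
  rw [Fin.succ_inj, Fin.succAbove_right_inj]

theorem gAux_ne_zero {m : ℕ} (v : Fin (m + 1)) (a : Fin m) : gAux v a ≠ 0 := Fin.succ_ne_zero _

theorem gAux_ne {m : ℕ} (v : Fin (m + 1)) (a : Fin m) : gAux v a ≠ v.succ := by
  unfold gAux
  rw [Ne, Fin.succ_inj]
  exact Fin.succAbove_ne _ _

theorem gAux_surj {m : ℕ} (v : Fin (m + 1)) (y : Fin (m + 2)) (h0 : y ≠ 0) (h1 : y ≠ v.succ) :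
    ∃ x, gAux v x = y := by
  obtain ⟨z, rfl⟩ := Fin.exists_succ_eq.2 h0
  have hz : z ≠ v := fun h => h1 (by rw [h])
  obtain ⟨x, rfl⟩ := Fin.exists_succAbove_eq hz
  exact ⟨x, rfl⟩

def fFun {m : ℕ} (v : Fin (m + 1)) (σ : Equiv.Perm (Fin m)) (i : Fin (m + 2)) : Fin (m + 2) :=
  if h : (i : ℕ) < m then gAux v (σ ⟨i, h⟩) else if (i : ℕ) = m then 0 else v.succ

theorem fFun_inj {m : ℕ} (v : Fin (m + 1)) (σ : Equiv.Perm (Fin m)) :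
    Function.Injective (fFun v σ) := by
  intro i j h
  unfold fFun at h
  have hi := i.2
  have hj := j.2
  have := Fin.succ_ne_zero v
  split_ifs at h with h1 h2 h3 h4 h5 h6 h7
  · rw [gAux_inj] at h
    have := σ.injective h
    simpa [Fin.ext_iff] using this
  · exact absurd h (gAux_ne_zero _ _)
  · exact absurd h (gAux_ne _ _)
  · exact absurd h.symm (gAux_ne_zero _ _)
  · apply Fin.ext; omega
  · exact absurd h.symm this
  · exact absurd h.symm (gAux_ne _ _)
  · exact absurd h this
  · apply Fin.ext; omega

noncomputable def fPerm {m : ℕ} (v : Fin (m + 1)) (σ : Equiv.Perm (Fin m)) :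
    Equiv.Perm (Fin (m + 2)) :=
  Equiv.ofBijective (fFun v σ) (Finite.injective_iff_bijective.1 (fFun_inj v σ))

theorem fPerm_lt {m : ℕ} (v : Fin (m + 1)) (σ : Equiv.Perm (Fin m)) (i : ℕ) (h : i < m)
    (h' : i < m + 2) : fPerm v σ ⟨i, h'⟩ = gAux v (σ ⟨i, h⟩) := by
  simp [fPerm, fFun, h]

theorem fPerm_mid {m : ℕ} (v : Fin (m + 1)) (σ : Equiv.Perm (Fin m)) 
    (h' : m < m + 2) : fPerm v σ ⟨m, h'⟩ = 0 := by
  simp [fPerm, fFun]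

theorem fPerm_last {m : ℕ} (v : Fin (m + 1)) (σ : Equiv.Perm (Fin m)) 
    (h' : m + 1 < m + 2) : fPerm v σ ⟨m + 1, h'⟩ = v.succ := by
  simp [fPerm, fFun]

theorem fPerm_inj {m : ℕ} (v w : Fin (m + 1)) (σ τ : Equiv.Perm (Fin m))
    (h : fPerm v σ = fPerm w τ) : v = w ∧ σ = τ := by
  have h1 := fPerm_last v σ (by omega)
  rw [h, fPerm_last, Fin.succ_inj] at h1
  subst h1
  refine ⟨rfl, ?_⟩
  ext1 i
  have h2 := fPerm_lt w σ i i.2 (by omega)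
  rw [h, fPerm_lt w τ i i.2, gAux_inj] at h2
  exact h2.symm

theorem fPerm_surj {m : ℕ} (π : Equiv.Perm (Fin (m + 2))) (h : π ⟨m, by omega⟩ = 0) :
    ∃ v σ, fPerm v σ = π := by
  have h1 : π ⟨m + 1, by omega⟩ ≠ 0 := by
    rw [← h]
    intro e
    have := π.injective e
    simp at this
  obtain ⟨v, hv⟩ := Fin.exists_succ_eq.2 h1
  have key : ∀ i : Fin m, ∃ x, gAux v x = π ⟨i, by omega⟩ := by
    intro i
    have hi := i.2
    apply gAux_surj
    · rw [← h]
      intro e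
      have := π.injective e
      simp at this
      omega
    · rw [hv]
      intro e
      have := π.injective e
      simp at this
      omega
  choose s hs using key
  have hinj : Function.Injective s := by
    intro i j e
    have h3 : π ⟨i, by omega⟩ = π ⟨j, by omega⟩ := by rw [← hs, ← hs, e]
    have := π.injective h3
    simpa [Fin.ext_iff] using this
  refine ⟨v, Equiv.ofBijective s (Finite.injective_iff_bijective.1 hinj), ?_⟩
  ext1 i
  obtain ⟨i, hi⟩ := i
  rcases lt_trichotomy i m with hlt | rfl | hgt
  · rw [fPerm_lt _ _ i hlt, Equiv.ofBijective_apply, hs]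
  · rw [fPerm_mid, h]
  · obtain rfl : i = m + 1 := by omega
    rw [fPerm_last, hv]

def QAux {m : ℕ} (k : ℕ) (σ : Equiv.Perm (Fin m)) : Prop :=
  Avoids1d23 σ ∧ k ≤ m + 1 ∧ ∀ i j : Fin m, i < j → (j : ℕ) < k → σ j < σ i

theorem good_iff {m : ℕ} (k : ℕ) (v : Fin (m + 1)) (σ : Equiv.Perm (Fin m)) :
    (Avoids1d23 (fPerm v σ) ∧ BeginsDec (fPerm v σ) k ∧ EndsInc12 (fPerm v σ)) ↔ QAux k σ := by
  constructor
  · rintro ⟨ha, ⟨hk, hb⟩, -⟩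
    refine ⟨?_, ?_, ?_⟩
    · rintro ⟨i, j, h, hij, h1, h2⟩
      refine ha ⟨⟨i, by omega⟩, ⟨j, by omega⟩, by simp only; omega, hij, ?_, ?_⟩
      · rw [fPerm_lt _ _ i i.2, fPerm_lt _ _ j j.2, gAux_lt]
        exact h1
      · rw [fPerm_lt _ _ j j.2, fPerm_lt _ _ _ h, gAux_lt]
        exact h2
    · by_contra hc
      have := hb ⟨m, by omega⟩ ⟨m + 1, by omega⟩ (by simp) (by simp only; omega)
      rw [fPerm_mid] at this
      exact absurd this (Fin.not_lt_zero _)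
    · intro i j hij hj
      have := hb ⟨i, by omega⟩ ⟨j, by omega⟩ hij hj
      rwa [fPerm_lt _ _ i i.2, fPerm_lt _ _ j j.2, gAux_lt] at this
  · rintro ⟨ha, hk, hb⟩
    refine ⟨?_, ⟨by omega, ?_⟩, ⟨by omega, ?_⟩⟩
    · rintro ⟨⟨i, hi⟩, ⟨j, hj⟩, h, hij, h1, h2⟩
      simp only [Fin.mk_lt_mk] at h hij h2
      rcases Nat.lt_or_ge j m with hlt | hge
      · rcases Nat.lt_or_ge (j + 1) m with hlt2 | hge2
        · rw [fPerm_lt _ _ i (by omega), fPerm_lt _ _ j hlt, gAux_lt] at h1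
          rw [fPerm_lt _ _ j hlt, fPerm_lt _ _ (j + 1) hlt2, gAux_lt] at h2
          exact ha ⟨_, _, hlt2, hij, h1, h2⟩
        · obtain rfl : m = j + 1 := by omega
          rw [fPerm_mid] at h2
          exact absurd h2 (Fin.not_lt_zero _)
      · obtain rfl : j = m := by omega
        rw [fPerm_mid] at h1
        exact absurd h1 (Fin.not_lt_zero _)
    · rintro ⟨i, hi⟩ ⟨j, hj⟩ hij hjk
      simp only [Fin.mk_lt_mk] at hij hjk
      rcases Nat.lt_or_ge j m with hlt | hge
      · rw [fPerm_lt _ _ i (by omega), fPerm_lt _ _ j hlt, gAux_lt]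
        exact hb _ _ hij hjk
      · obtain rfl : j = m := by omega
        rw [fPerm_mid, fPerm_lt _ _ i (by omega)]
        exact Fin.pos_iff_ne_zero.2 (gAux_ne_zero _ _)
    · have e1 : (⟨m + 2 - 2, by omega⟩ : Fin (m + 2)) = ⟨m, by omega⟩ := by simp
      have e2 : (⟨m + 2 - 1, by omega⟩ : Fin (m + 2)) = ⟨m + 1, by omega⟩ := by simp
      rw [e1, e2, fPerm_mid, fPerm_last]
      exact Fin.succ_pos _

theorem good_mid {m : ℕ} (π : Equiv.Perm (Fin (m + 2))) (ha : Avoids1d23 π) (he : EndsInc12 π) :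
    π ⟨m, by omega⟩ = 0 := by
  obtain ⟨_, he⟩ := he
  have e1 : (⟨m + 2 - 2, by omega⟩ : Fin (m + 2)) = ⟨m, by omega⟩ := by simp
  have e2 : (⟨m + 2 - 1, by omega⟩ : Fin (m + 2)) = ⟨m + 1, by omega⟩ := by simp
  rw [e1, e2] at he
  by_contra hne
  have hpos := Fin.pos_iff_ne_zero.2 hne
  obtain ⟨⟨i, hi⟩, h0⟩ := π.surjective 0
  rcases lt_trichotomy i m with hlt | rfl | hgt
  · exact ha ⟨⟨i, hi⟩, ⟨m, by omega⟩, by simp, hlt, by rwa [h0], he⟩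
  · exact hne h0
  · obtain rfl : i = m + 1 := by omega
    rw [h0] at he
    exact absurd he (Fin.not_lt_zero _)

theorem card_good_s17 (m k : ℕ) :
    Nat.card {π : Equiv.Perm (Fin (m + 2)) // Avoids1d23 π ∧ BeginsDec π k ∧ EndsInc12 π}
      = (m + 1) * Nat.card {σ : Equiv.Perm (Fin m) // QAux k σ} := by
  have h : Nat.card (Fin (m + 1) × {σ : Equiv.Perm (Fin m) // QAux k σ})
      = (m + 1) * Nat.card {σ : Equiv.Perm (Fin m) // QAux k σ} := by
    rw [Nat.card_prod, Nat.card_fin]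
  rw [← h]
  symm
  refine Nat.card_congr (Equiv.ofBijective
    (fun p => ⟨fPerm p.1 p.2.1, (good_iff k p.1 p.2.1).2 p.2.2⟩) ⟨?_, ?_⟩)
  · rintro ⟨v, σ, hσ⟩ ⟨w, τ, hτ⟩ e
    simp only [Subtype.mk.injEq] at e
    obtain ⟨rfl, rfl⟩ := fPerm_inj _ _ _ _ e
    rfl
  · rintro ⟨π, hπ⟩
    obtain ⟨v, σ, rfl⟩ := fPerm_surj π (good_mid π hπ.1 hπ.2.2)
    exact ⟨⟨v, σ, (good_iff k v σ).1 hπ⟩, rfl⟩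

theorem card_Q_dec (m : ℕ) : Nat.card {σ : Equiv.Perm (Fin m) // QAux (m + 1) σ} = 1 := by
  rw [Nat.card_eq_one_iff_unique]
  constructor
  · constructor
    rintro ⟨σ, _, _, hσ⟩ ⟨τ, _, _, hτ⟩
    have key : ∀ ρ : Equiv.Perm (Fin m), (∀ i j : Fin m, i < j → (j : ℕ) < m + 1 → ρ j < ρ i) →
        ∀ i, ρ i = Fin.rev i := by
      intro ρ hρ i
      have hm : StrictMono (fun i => Fin.rev (ρ i)) := by
        intro a b hab
        exact Fin.rev_lt_rev.2 (hρ a b hab (by omega))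
      have h3 : (fun i => Fin.rev (ρ i)) = id := by
        have hs : Function.Surjective (fun i => Fin.rev (ρ i)) :=
          Fin.rev_surjective.comp ρ.surjective
        have := Subsingleton.elim (hm.orderIsoOfSurjective _ hs) (OrderIso.refl _)
        ext1 x
        exact congrArg (fun f : Fin m ≃o Fin m => f x) this
      have h4 := congrFun h3 i
      simp only [id] at h4
      rw [← h4, Fin.rev_rev, h4]
    apply Subtype.ext
    ext1 i
    show σ i = τ i
    rw [key σ hσ, key τ hτ]
  · refine ⟨⟨Fin.revPerm, ?_, le_rfl, ?_⟩⟩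
    · rintro ⟨i, j, h, hij, h1, h2⟩
      simp only [Fin.revPerm_apply, Fin.rev_lt_rev] at h1
      exact absurd h1 hij.le.not_gt
    · intro i j hij _
      simpa using hij

theorem avoid1d23_beginDec_end12_count (k n : ℕ) (hk : 1 ≤ k) (hn : 1 ≤ n) :
    Nat.card {π : Equiv.Perm (Fin (n + 1)) // Avoids1d23 π ∧ BeginsDec π k ∧ EndsInc12 π}
      = n * M k (n - 1) + k * (if n = k then 1 else 0) := by
  obtain ⟨m, rfl⟩ : ∃ m, n = m + 1 := ⟨n - 1, by omega⟩
  rw [card_good_s17, Nat.add_sub_cancel]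
  have hM0 : m < k → M k m = 0 := by
    intro h
    unfold M
    have : IsEmpty {π : Equiv.Perm (Fin m) // Avoids1d23 π ∧ BeginsDec π k} :=
      ⟨fun p => by have := p.2.2.1; omega⟩
    exact Nat.card_of_isEmpty
  rcases lt_trichotomy k (m + 1) with h | rfl | h
  · rw [if_neg (by omega), mul_zero, add_zero]
    congr 1
    unfold M
    refine Nat.card_congr (Equiv.subtypeEquivRight fun σ => ?_)
    unfold QAux BeginsDec
    have h1 : k ≤ m + 1 := by omega
    have h2 : k ≤ m := by omega
    simp only [h1, h2]
  · rw [card_Q_dec, hM0 (by omega), if_pos rfl]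
    simp
  · rw [hM0 (by omega), if_neg (by omega)]
    have : IsEmpty {σ : Equiv.Perm (Fin m) // QAux k σ} :=
      ⟨fun p => by have := p.2.2.1; omega⟩
    rw [Nat.card_of_isEmpty]
    simp
end
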